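/- Let T ⊂ ℝ^d be a bounded convex set of diameter H and let Π be the L²(T)-orthogonal projection onto constants. Then for all v ∈ H¹(T), ‖v − Πv‖_{L²(T)} ≤ (H/π) ‖∇v‖_{L²(T)}. -/

import Mathlib

open MeasureTheory

open scoped ENNReal in
lemma pw_bm1 {s : ℝ} (hs0 : 0 < s) (hs1 : s < 1) {A B C : Set ℝ} (hA : MeasurableSet A)
    (hB : MeasurableSet B) (hAn : A.Nonempty) (hBn : B.Nonempty)
    (hC : ∀ a ∈ A, ∀ b ∈ B, (1 - s) * a + s * b ∈ C) :
    ENNReal.ofReal (1 - s) * volume A + ENNReal.ofReal s * volume B ≤ volume C := by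
  obtain ⟨a0, ha0⟩ := hAn
  obtain ⟨b0, hb0⟩ := hBn
  have hs1' : 0 < 1 - s := by linarith
  rw [hA.measure_eq_iSup_isCompact, hB.measure_eq_iSup_isCompact]
  simp only [ENNReal.mul_iSup, iSup_and']
  refine ENNReal.biSup_add_biSup_le' ⟨∅, by simp⟩ ⟨∅, by simp⟩ ?_
  rintro K₁ ⟨hK₁, hc₁⟩ K₂ ⟨hK₂, hc₂⟩
  have hc₁' : IsCompact (insert a0 K₁) := hc₁.insert a0
  have hc₂' : IsCompact (insert b0 K₂) := hc₂.insert b0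
  obtain ⟨a, haK, ha⟩ := hc₁'.exists_isGreatest (Set.insert_nonempty _ _)
  obtain ⟨b, hbK, hb⟩ := hc₂'.exists_isLeast (Set.insert_nonempty _ _)
  have hI₁ : insert a0 K₁ ⊆ A := Set.insert_subset ha0 hK₁
  have hI₂ : insert b0 K₂ ⊆ B := Set.insert_subset hb0 hK₂
  set D₁ := (fun x : ℝ => s * b + x) '' ((fun x : ℝ => (1 - s) * x) '' K₁)
  set D₂ := (fun x : ℝ => (1 - s) * a + x) '' ((fun x : ℝ => s * x) '' K₂)
  have hvol : ∀ c : ℝ, 0 < c → ∀ K : Set ℝ,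
      volume ((fun x : ℝ => c * x) '' K) = ENNReal.ofReal c * volume K := by
    intro c hc K
    have := Measure.addHaar_image_linearMap (volume : Measure ℝ) (LinearMap.mul ℝ ℝ c) K
    simpa [abs_of_pos hc] using this
  have hD₁ : volume D₁ = ENNReal.ofReal (1 - s) * volume K₁ := by
    simp only [D₁, Set.image_add_left, measure_preimage_add]
    exact hvol _ hs1' _
  have hD₂ : volume D₂ = ENNReal.ofReal s * volume K₂ := by
    simp only [D₂, Set.image_add_left, measure_preimage_add]
    exact hvol _ hs0 _
  have hm₂ : MeasurableSet D₂ := by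
    apply IsCompact.measurableSet
    exact (hc₂.image (by fun_prop)).image (by fun_prop)
  rw [← hD₁, ← hD₂]
  have hdisj : AEDisjoint volume D₁ D₂ := by
    refine measure_mono_null (t := {(1 - s) * a + s * b}) ?_ (by simp)
    rintro _ ⟨⟨_, ⟨x, hx, rfl⟩, rfl⟩, ⟨_, ⟨y, hy, rfl⟩, hxy⟩⟩
    have h1 : x ≤ a := ha (Set.mem_insert_of_mem _ hx)
    have h2 : b ≤ y := hb (Set.mem_insert_of_mem _ hy)
    simp only at hxy
    have h3 := mul_le_mul_of_nonneg_left h1 hs1'.le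
    have h4 := mul_le_mul_of_nonneg_left h2 hs0.le
    simp only [Set.mem_singleton_iff]
    linarith
  rw [← measure_union₀ hm₂.nullMeasurableSet hdisj]
  apply measure_mono
  rintro _ (⟨_, ⟨x, hx, rfl⟩, rfl⟩ | ⟨_, ⟨y, hy, rfl⟩, rfl⟩)
  · have := hC x (hK₁ hx) b (hI₂ hbK)
    simpa [add_comm] using this
  · exact hC a (hI₁ haK) y (hK₂ hy)

open scoped ENNReal in
lemma pw_pl1_norm {s : ℝ} (hs0 : 0 < s) (hs1 : s < 1) {f g h : ℝ → ℝ≥0∞} (hf : Measurable f)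
    (hg : Measurable g) (hh : Measurable h) (hf1 : ⨆ x, f x = 1) (hg1 : ⨆ x, g x = 1)
    (H : ∀ x y, f x ^ (1 - s) * g y ^ s ≤ h ((1 - s) * x + s * y)) :
    ENNReal.ofReal (1 - s) * (∫⁻ x, f x) + ENNReal.ofReal s * (∫⁻ x, g x) ≤ ∫⁻ x, h x := by
  have hfle : ∀ x, f x ≤ 1 := fun x => hf1 ▸ le_iSup f x
  have hgle : ∀ x, g x ≤ 1 := fun x => hg1 ▸ le_iSup g x
  have key : ∀ u : ℝ → ℝ≥0∞, Measurable u → (∀ x, u x ≤ 1) →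
      ∫⁻ x, u x = ∫⁻ t in Set.Ioi (0:ℝ), volume {x | ENNReal.ofReal t < u x} := by
    intro u hu hu1
    have h1 : ∀ x, u x ≠ ∞ := fun x => ((hu1 x).trans_lt ENNReal.one_lt_top).ne
    have := lintegral_eq_lintegral_meas_lt (volume : Measure ℝ) (f := fun x => (u x).toReal)
      (Filter.Eventually.of_forall fun x => ENNReal.toReal_nonneg) hu.ennreal_toReal.aemeasurable
    simp only [ENNReal.ofReal_toReal (h1 _)] at this
    rw [this]
    refine setLIntegral_congr_fun measurableSet_Ioi ?_
    intro t ht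
    simp only [ENNReal.ofReal_lt_iff_lt_toReal (le_of_lt ht) (h1 _)]
  have hle : ∫⁻ x, min (h x) 1 ≤ ∫⁻ x, h x := lintegral_mono fun x => min_le_left _ _
  refine le_trans ?_ hle
  rw [key f hf hfle, key g hg hgle, key _ (hh.min measurable_const) (fun x => min_le_right _ _)]
  have hmeas : ∀ u : ℝ → ℝ≥0∞, Measurable fun t : ℝ => volume {x | ENNReal.ofReal t < u x} := by
    intro u
    apply Antitone.measurable
    intro t t' htt
    exact measure_mono fun x hx => lt_of_le_of_lt (ENNReal.ofReal_le_ofReal htt) hx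
  rw [← lintegral_const_mul _ (hmeas f), ← lintegral_const_mul _ (hmeas g),
    ← lintegral_add_left ((hmeas f).const_mul _)]
  refine setLIntegral_mono (hmeas _) ?_
  intro t ht
  by_cases ht1 : t < 1
  · have ht1' : ENNReal.ofReal t < 1 := by
      rw [← ENNReal.ofReal_one]; exact (ENNReal.ofReal_lt_ofReal_iff one_pos).2 ht1
    refine pw_bm1 hs0 hs1 (measurableSet_lt measurable_const hf)
      (measurableSet_lt measurable_const hg) ?_ ?_ ?_
    · rw [← hf1] at ht1'; exact lt_iSup_iff.1 ht1'
    · rw [← hg1] at ht1'; exact lt_iSup_iff.1 ht1'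
    · intro x hx y hy
      refine lt_min (lt_of_lt_of_le ?_ (H x y)) ht1'
      have h0 : ENNReal.ofReal t ≠ 0 := by simpa using ht
      have e : ENNReal.ofReal t = ENNReal.ofReal t ^ (1 - s) * ENNReal.ofReal t ^ s := by
        rw [← ENNReal.rpow_add _ _ h0 ENNReal.ofReal_ne_top]; simp
      rw [e]
      exact ENNReal.mul_lt_mul (ENNReal.rpow_lt_rpow hx (by linarith)) (ENNReal.rpow_lt_rpow hy hs0)
  · have ht1' : 1 ≤ ENNReal.ofReal t := by
      rw [← ENNReal.ofReal_one]; exact ENNReal.ofReal_le_ofReal (not_lt.1 ht1)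
    have e1 : {x | ENNReal.ofReal t < f x} = ∅ := by
      ext x; simpa using (hfle x).trans ht1'
    have e2 : {x | ENNReal.ofReal t < g x} = ∅ := by
      ext x; simpa using (hgle x).trans ht1'
    simp [e1, e2]

open scoped ENNReal in
lemma pw_amgm {s : ℝ} (hs0 : 0 < s) (hs1 : s < 1) (x y : ℝ≥0∞) :
    x ^ (1 - s) * y ^ s ≤ ENNReal.ofReal (1 - s) * x + ENNReal.ofReal s * y := by
  have h1 : 0 < 1 - s := by linarith
  have hpq : (1 - s)⁻¹.HolderConjugate s⁻¹ := by
    refine Real.holderConjugate_iff.2 ⟨?_, ?_⟩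
    · exact (one_lt_inv₀ h1).2 (by linarith)
    · simp
  have := ENNReal.young_inequality (x ^ (1 - s)) (y ^ s) hpq
  rw [← ENNReal.rpow_mul, ← ENNReal.rpow_mul, mul_inv_cancel₀ h1.ne', mul_inv_cancel₀ hs0.ne',
    ENNReal.rpow_one, ENNReal.rpow_one, ENNReal.ofReal_inv_of_pos h1, ENNReal.ofReal_inv_of_pos hs0,
    div_eq_mul_inv, div_eq_mul_inv, inv_inv, inv_inv] at this
  simpa [mul_comm] using this

open scoped ENNReal in
lemma pw_pl1_bdd {s : ℝ} (hs0 : 0 < s) (hs1 : s < 1) {f g h : ℝ → ℝ≥0∞} (hf : Measurable f)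
    (hg : Measurable g) (hh : Measurable h) (hf1 : ⨆ x, f x ≠ ∞) (hg1 : ⨆ x, g x ≠ ∞)
    (H : ∀ x y, f x ^ (1 - s) * g y ^ s ≤ h ((1 - s) * x + s * y)) :
    (∫⁻ x, f x) ^ (1 - s) * (∫⁻ x, g x) ^ s ≤ ∫⁻ x, h x := by
  have h1 : 0 < 1 - s := by linarith
  set A := ⨆ x, f x with hA
  set B := ⨆ x, g x with hB
  by_cases hA0 : A = 0
  · have : ∀ x, f x = 0 := fun x => le_antisymm (hA0 ▸ le_iSup f x) bot_le
    simp [this, h1]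
  by_cases hB0 : B = 0
  · have : ∀ x, g x = 0 := fun x => le_antisymm (hB0 ▸ le_iSup g x) bot_le
    simp [this, hs0]
  set c := A ^ (1 - s) * B ^ s with hc
  have hc0 : c ≠ 0 := mul_ne_zero (by simp [hA0, hf1]) (by simp [hB0, hg1])
  have hct : c ≠ ∞ := ENNReal.mul_ne_top (ENNReal.rpow_ne_top_of_nonneg h1.le hf1)
    (ENNReal.rpow_ne_top_of_nonneg hs0.le hg1)
  have hAB : ∀ x y : ℝ≥0∞, (A⁻¹ * x) ^ (1 - s) * (B⁻¹ * y) ^ s = c⁻¹ * (x ^ (1 - s) * y ^ s) := by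
    intro x y
    rw [ENNReal.mul_rpow_of_nonneg _ _ h1.le, ENNReal.mul_rpow_of_nonneg _ _ hs0.le, hc,
      ENNReal.mul_inv (by simp [hA0, hf1]) (by simp [hB0, hg1]), ENNReal.inv_rpow, ENNReal.inv_rpow]
    ring
  have := pw_pl1_norm hs0 hs1 (hf.const_mul A⁻¹) (hg.const_mul B⁻¹) (hh.const_mul c⁻¹)
    (by rw [← ENNReal.mul_iSup]; exact ENNReal.inv_mul_cancel hA0 hf1)
    (by rw [← ENNReal.mul_iSup]; exact ENNReal.inv_mul_cancel hB0 hg1)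
    (fun x y => by rw [hAB]; exact mul_le_mul_right (H x y) _)
  have h2 := (pw_amgm hs0 hs1 _ _).trans this
  rw [lintegral_const_mul _ hf, lintegral_const_mul _ hg, lintegral_const_mul _ hh, hAB] at h2
  exact (ENNReal.mul_le_mul_iff_right (by simp [hct]) (by simp [hc0])).1 h2

open scoped ENNReal in
lemma pw_pl1 {s : ℝ} (hs0 : 0 < s) (hs1 : s < 1) {f g h : ℝ → ℝ≥0∞} (hf : Measurable f)
    (hg : Measurable g) (hh : Measurable h)
    (H : ∀ x y, f x ^ (1 - s) * g y ^ s ≤ h ((1 - s) * x + s * y)) :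
    (∫⁻ x, f x) ^ (1 - s) * (∫⁻ x, g x) ^ s ≤ ∫⁻ x, h x := by
  have h1 : 0 < 1 - s := by linarith
  by_cases hf0 : ∫⁻ x, f x = 0
  · simp [hf0, h1]
  by_cases hg0 : ∫⁻ x, g x = 0
  · simp [hg0, hs0]
  have key : ∀ u : ℝ → ℝ≥0∞, Measurable u →
      Filter.Tendsto (fun n : ℕ => ∫⁻ x, min (u x) n) Filter.atTop (nhds (∫⁻ x, u x)) := by
    intro u hu
    apply lintegral_tendsto_of_tendsto_of_monotone
    · intro n; exact (hu.min measurable_const).aemeasurable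
    · refine Filter.Eventually.of_forall fun x n m hnm => ?_
      exact min_le_min_left _ (by exact_mod_cast hnm)
    · refine Filter.Eventually.of_forall fun x => ?_
      have : Filter.Tendsto (fun n : ℕ => min (u x) (n : ℝ≥0∞)) Filter.atTop (nhds (min (u x) ∞)) :=
        tendsto_const_nhds.min ENNReal.tendsto_nat_nhds_top
      simpa using this
  have hlim := ENNReal.Tendsto.mul
    ((ENNReal.continuous_rpow_const (y := 1 - s)).continuousAt.tendsto.comp (key f hf))
    (Or.inl (by simp [hf0, h1, h1.not_gt]))
    ((ENNReal.continuous_rpow_const (y := s)).continuousAt.tendsto.comp (key g hg))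
    (Or.inl (by simp [hg0, hs0, hs0.not_gt]))
  refine le_of_tendsto' hlim fun n => ?_
  have hb : ∀ u : ℝ → ℝ≥0∞, ⨆ x, min (u x) (n : ℝ≥0∞) ≠ ∞ := fun u =>
    ((iSup_le fun x => min_le_right _ _).trans_lt (ENNReal.natCast_lt_top n)).ne
  refine pw_pl1_bdd hs0 hs1 (hf.min measurable_const) (hg.min measurable_const) hh
    (hb f) (hb g) fun x y => le_trans ?_ (H x y)
  gcongr
  · exact min_le_left _ _
  · exact min_le_left _ _

open scoped ENNReal in
lemma pw_pl {s : ℝ} (hs0 : 0 < s) (hs1 : s < 1) (n : ℕ) : ∀ {f g h : (Fin n → ℝ) → ℝ≥0∞},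
    Measurable f → Measurable g → Measurable h →
    (∀ x y, f x ^ (1 - s) * g y ^ s ≤ h ((1 - s) • x + s • y)) →
    (∫⁻ x, f x) ^ (1 - s) * (∫⁻ x, g x) ^ s ≤ ∫⁻ x, h x := by
  induction n with
  | zero =>
    intro f g h hf hg hh H
    have e : (volume : Measure (Fin 0 → ℝ)) = Measure.dirac 0 := by
      rw [volume_pi, Measure.pi_of_empty _ 0]
    simp only [e, lintegral_dirac]
    simpa using H 0 0
  | succ n ih =>
    intro f g h hf hg hh H
    have mp := (volume_preserving_piFinSuccAbove (fun _ : Fin (n + 1) => ℝ) 0).symm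
    have key : ∀ u : (Fin (n + 1) → ℝ) → ℝ≥0∞, Measurable u →
        Measurable (fun t : ℝ => ∫⁻ y : Fin n → ℝ, u (Fin.cons t y)) ∧
        (∀ t : ℝ, Measurable (fun y : Fin n → ℝ => u (Fin.cons t y))) ∧
        ∫⁻ x, u x = ∫⁻ t : ℝ, ∫⁻ y : Fin n → ℝ, u (Fin.cons t y) := by
      intro u hu
      have hm : Measurable fun z : ℝ × (Fin n → ℝ) =>
          u ((MeasurableEquiv.piFinSuccAbove (fun _ : Fin (n + 1) => ℝ) 0).symm z) :=
        hu.comp (MeasurableEquiv.measurable _)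
      have e : ∀ t y, (MeasurableEquiv.piFinSuccAbove (fun _ : Fin (n + 1) => ℝ) 0).symm (t, y)
        = (Fin.cons t y : Fin (n + 1) → ℝ) := by
        intro t y
        simp [MeasurableEquiv.piFinSuccAbove, Fin.insertNthEquiv]
      refine ⟨?_, ?_, ?_⟩
      · have := hm.lintegral_prod_right' (ν := volume)
        simpa only [e] using this
      · intro t
        have := hm.comp (measurable_prodMk_left (x := t))
        simpa only [Function.comp_def, e] using this
      · rw [← mp.lintegral_comp hu, Measure.volume_eq_prod, lintegral_prod _ hm.aemeasurable]
        simp only [e]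
    obtain ⟨f1, f2, f3⟩ := key f hf
    obtain ⟨g1, g2, g3⟩ := key g hg
    obtain ⟨h1, h2, h3⟩ := key h hh
    rw [f3, g3, h3]
    refine pw_pl1 hs0 hs1 f1 g1 h1 fun t t' => ?_
    refine ih (f2 t) (g2 t') (h2 _) fun y y' => ?_
    refine (H _ _).trans (le_of_eq ?_)
    congr 1
    ext i
    refine Fin.cases ?_ (fun j => ?_) i <;> simp

lemma pw_smv {q g g' : ℝ → ℝ} {u r : ℝ} (hur : u ≤ r) (hq : AntitoneOn q (Set.Ici u))
    (hq0 : ∀ x, 0 ≤ q x) (hqm : Measurable q) (hg : ∀ x, HasDerivAt g (g' x) x)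
    (hg' : Continuous g') (hg0 : ∀ x ∈ Set.Icc u r, 0 ≤ g x) :
    ∫ x in u..r, (-g' x) * q x ≤ q u * g u := by
  have hgu : 0 ≤ g u := hg0 u ⟨le_rfl, hur⟩
  have inner : ∀ s : ℝ, ∫ x in Set.Ioc u r, (if s < q x then -g' x else 0) ≤ g u := by
    intro s
    set S := {x | x ∈ Set.Ioc u r ∧ s < q x} with hS
    have hSm : MeasurableSet S := measurableSet_Ioc.inter (measurableSet_lt measurable_const hqm)
    have e : ∫ x in Set.Ioc u r, (if s < q x then -g' x else 0) = ∫ x in S, -g' x := by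
      have : (fun x => if s < q x then -g' x else 0) = Set.indicator {x | s < q x} (fun x => -g' x) := by
        ext x; simp [Set.indicator]
      rw [this, setIntegral_indicator (measurableSet_lt measurable_const hqm)]
      rfl
    rw [e]
    rcases S.eq_empty_or_nonempty with h | ⟨y, hy⟩
    · rw [h]; simpa using hgu
    · have hbdd : BddAbove S := ⟨r, fun x hx => hx.1.2⟩
      set t := sSup S
      have hyt : y ≤ t := le_csSup hbdd hy
      have hut : u ≤ t := hy.1.1.le.trans hyt
      have htr : t ≤ r := csSup_le ⟨y, hy⟩ fun x hx => hx.1.2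
      have hae : S =ᵐ[volume] Set.Ioc u t := by
        have h1 : Set.Ioo u t ⊆ S := by
          intro x hx
          obtain ⟨z, hz, hxz⟩ := exists_lt_of_lt_csSup ⟨y, hy⟩ hx.2
          refine ⟨⟨hx.1, hx.2.le.trans htr⟩, hz.2.trans_le ?_⟩
          exact hq hx.1.le hz.1.1.le hxz.le
        have h2 : S ⊆ Set.Ioc u t := fun x hx => ⟨hx.1.1, le_csSup hbdd hx⟩
        refine Filter.EventuallyLE.antisymm (LE.le.eventuallyLE h2) ?_
        exact (Ioo_ae_eq_Ioc (μ := volume)).symm.le.trans (LE.le.eventuallyLE h1)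
      rw [setIntegral_congr_set hae, ← intervalIntegral.integral_of_le hut,
        intervalIntegral.integral_neg, intervalIntegral.integral_eq_sub_of_hasDerivAt
          (fun x _ => hg x) (hg'.intervalIntegrable _ _)]
      linarith [hg0 t ⟨hut, htr⟩]
  have hrep : ∀ x ∈ Set.Ioc u r, (-g' x) * q x =
      ∫ s in Set.Ioc 0 (q u), (if s < q x then -g' x else 0) := by
    intro x hx
    have hle : q x ≤ q u := hq Set.self_mem_Ici hx.1.le hx.1.le
    have : (fun s => if s < q x then -g' x else 0) = Set.indicator (Set.Iio (q x)) (fun _ => -g' x) := by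
      ext x; simp [Set.indicator]
    rw [this, setIntegral_indicator measurableSet_Iio, setIntegral_const]
    have e2 : Set.Ioc 0 (q u) ∩ Set.Iio (q x) = Set.Ioo 0 (q x) := by
      ext s; simp only [Set.mem_inter_iff, Set.mem_Ioc, Set.mem_Iio, Set.mem_Ioo]
      constructor
      · rintro ⟨⟨a, b⟩, c⟩; exact ⟨a, c⟩
      · rintro ⟨a, c⟩; exact ⟨⟨a, (c.trans_le hle).le⟩, c⟩
    rw [e2]
    simp [hq0 x, mul_comm]
  rw [intervalIntegral.integral_of_le hur, setIntegral_congr_fun measurableSet_Ioc hrep]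
  obtain ⟨C, hC⟩ := (isCompact_Icc (a := u) (b := r)).exists_bound_of_continuousOn hg'.continuousOn
  have hint : Integrable (Function.uncurry fun x s : ℝ => if s < q x then -g' x else 0)
      ((volume.restrict (Set.Ioc u r)).prod (volume.restrict (Set.Ioc 0 (q u)))) := by
    have hm : Measurable (Function.uncurry fun x s : ℝ => if s < q x then -g' x else 0) := by
      refine Measurable.ite (measurableSet_lt measurable_snd (hqm.comp measurable_fst)) ?_
        measurable_const
      exact (hg'.measurable.comp measurable_fst).neg
    refine Integrable.of_bound hm.aestronglyMeasurable C ?_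
    rw [Measure.prod_restrict]
    refine (ae_restrict_iff' (measurableSet_Ioc.prod measurableSet_Ioc)).2 ?_
    refine Filter.Eventually.of_forall ?_
    rintro ⟨x, s⟩ ⟨hx, -⟩
    have := hC x ⟨hx.1.le, hx.2⟩
    simp only [Function.uncurry]
    split_ifs
    · simpa using this
    · simpa using (norm_nonneg _).trans this
  rw [integral_integral_swap hint]
  calc _ ≤ ∫ s in Set.Ioc 0 (q u), g u := by
        exact integral_mono hint.integral_prod_right (integrable_const _) inner
    _ = q u * g u := by simp [hq0 u]

noncomputable def pwphi (k b x : ℝ) : ℝ := Real.exp (-(b * x)) * (k * Real.sin (k * x) - b * Real.cos (k * x))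

lemma pwphi_cont (k b : ℝ) : Continuous (pwphi k b) := by unfold pwphi; fun_prop

lemma pwphi_neg (k b x : ℝ) : pwphi k (-b) (-x) = - pwphi k b x := by
  simp [pwphi]; ring

lemma pwphi_deriv (k b x : ℝ) :
    HasDerivAt (pwphi k b) ((k ^ 2 + b ^ 2) * (Real.exp (-(b * x)) * Real.cos (k * x))) x := by
  have h1 : HasDerivAt (fun x : ℝ => k * x) k x := by simpa using (hasDerivAt_id x).const_mul k
  have h2 : HasDerivAt (fun x : ℝ => -(b * x)) (-b) x := by
    simpa using ((hasDerivAt_id x).const_mul (-b))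
  have := h2.exp.mul ((h1.sin.const_mul k).sub (h1.cos.const_mul b))
  refine this.congr_deriv ?_
  simp only [Pi.sub_apply]
  ring

lemma pw_tail {p : ℝ → ℝ} {k b R u : ℝ} (hp0 : ∀ x, 0 ≤ p x) (hpm : Measurable p)
    (hpi : Integrable p) (hkR : k * R = Real.pi / 2) (hk : 0 < k)
    (hqc : ∀ x z y, x ≤ z → z ≤ y → min (p x * Real.exp (-(2 * b * x))) (p y * Real.exp (-(2 * b * y)))
      ≤ p z * Real.exp (-(2 * b * z)))
    (hM : ∫ x in (-R)..R, pwphi k b x * p x = 0) (hu1 : -R < u) (hu2 : u < R) :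
    ∫ x in u..R, pwphi k b x * p x ≤ p u * (Real.exp (-(b * u)) * Real.cos (k * u)) := by
  set q : ℝ → ℝ := fun x => p x * Real.exp (-(2 * b * x)) with hq
  have hq0 : ∀ x, 0 ≤ q x := fun x => mul_nonneg (hp0 x) (Real.exp_pos _).le
  have hqm : Measurable q := hpm.mul (by fun_prop)
  set g : ℝ → ℝ := fun x => Real.exp (b * x) * Real.cos (k * x) with hg
  set g' : ℝ → ℝ := fun x => Real.exp (b * x) * (b * Real.cos (k * x) - k * Real.sin (k * x)) with hg'
  have hgd : ∀ x, HasDerivAt g (g' x) x := by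
    intro x
    have h1 : HasDerivAt (fun x : ℝ => k * x) k x := by simpa using (hasDerivAt_id x).const_mul k
    have h2 : HasDerivAt (fun x : ℝ => b * x) b x := by
      simpa using ((hasDerivAt_id x).const_mul b)
    refine (h2.exp.mul h1.cos).congr_deriv ?_
    simp only [hg']; ring
  have hg'c : Continuous g' := by simp only [hg']; fun_prop
  have hg0 : ∀ x ∈ Set.Icc (-R) R, 0 ≤ g x := by
    intro x hx
    refine mul_nonneg (Real.exp_pos _).le (Real.cos_nonneg_of_mem_Icc ⟨?_, ?_⟩)
    · have := mul_le_mul_of_nonneg_left hx.1 hk.le; linarith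
    · have := mul_le_mul_of_nonneg_left hx.2 hk.le; linarith
  have hid : ∀ x, pwphi k b x * p x = (-g' x) * q x := by
    intro x
    simp only [pwphi, hq, hg']
    have : Real.exp (-(b * x)) = Real.exp (b * x) * Real.exp (-(2 * b * x)) := by
      rw [← Real.exp_add]; congr 1; ring
    rw [this]; ring
  have hend : q u * g u = p u * (Real.exp (-(b * u)) * Real.cos (k * u)) := by
    simp only [hq, hg]
    have : Real.exp (-(b * u)) = Real.exp (b * u) * Real.exp (-(2 * b * u)) := by
      rw [← Real.exp_add]; congr 1; ring
    rw [this]; ring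
  have hii : ∀ a c, IntervalIntegrable (fun x => pwphi k b x * p x) volume a c := fun a c =>
    (hpi.intervalIntegrable).continuousOn_mul (pwphi_cont k b).continuousOn
  rw [← hend]
  have hcase : AntitoneOn q (Set.Ici u) ∨ MonotoneOn q (Set.Iic u) := by
    by_contra hcon
    push Not at hcon
    simp only [AntitoneOn, MonotoneOn, not_forall, not_le, exists_prop, Set.mem_Ici, Set.mem_Iic] at hcon
    obtain ⟨⟨x, hx, y, hy, hxy, h1⟩, ⟨x', hx', y', hy', hxy', h2⟩⟩ := hcon
    have a1 := hqc x' y' y hxy' (hy'.trans hy)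
    have a2 := hqc y' x y (hy'.trans hx) hxy
    change min (q x') (q y) ≤ q y' at a1
    change min (q y') (q y) ≤ q x at a2
    rcases min_le_iff.1 a1 with h | h
    · linarith
    · rw [min_eq_right h] at a2; linarith
  rcases hcase with hanti | hmono
  · simp only [hid]
    exact pw_smv hu2.le hanti hq0 hqm hgd hg'c fun x hx => hg0 x ⟨hu1.le.trans hx.1, hx.2⟩
  · have hsum := intervalIntegral.integral_add_adjacent_intervals (hii (-R) u) (hii u R)
    rw [hM] at hsum
    have e : ∫ x in u..R, pwphi k b x * p x = ∫ x in (-R)..u, g' x * q x := by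
      have : ∀ x, g' x * q x = -(pwphi k b x * p x) := fun x => by rw [hid]; ring
      simp only [this, intervalIntegral.integral_neg]
      linarith
    rw [e]
    have := pw_smv (q := fun x => q (-x)) (g := fun x => g (-x)) (g' := fun x => -g' (-x))
      (u := -u) (r := R) (by linarith) (fun x hx y hy hxy => hmono (Set.mem_Iic.2 (by
        have := Set.mem_Ici.1 hy; linarith)) (Set.mem_Iic.2 (by
        have := Set.mem_Ici.1 hx; linarith)) (by linarith)) (fun x => hq0 _)
        (hqm.comp measurable_neg) (fun x => by
          have := (hgd (-x)).comp x (hasDerivAt_neg x)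
          simpa [Function.comp_def] using this) (by fun_prop)
        (fun x hx => hg0 _ ⟨by linarith [hx.2], by linarith [hx.1]⟩)
    simp only [neg_neg] at this
    rwa [intervalIntegral.integral_comp_neg (fun x => g' x * q x), neg_neg] at this

lemma pw_cs {V V' φ φ' : ℝ → ℝ} {x y : ℝ} (hxy : x < y) (hV : ∀ t, HasDerivAt V (V' t) t)
    (hV' : Continuous V') (hφ : ∀ t, HasDerivAt φ (φ' t) t) (hφ' : Continuous φ')
    (hpos : ∀ t ∈ Set.Icc x y, 0 < φ' t) (hφ0 : φ x = 0) (hφy : 0 < φ y) :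
    (V y - V x) ^ 2 ≤ φ y * ∫ t in x..y, V' t ^ 2 / φ' t := by
  have hcW : ContinuousOn (fun t => V' t ^ 2 / φ' t) (Set.uIcc x y) := by
    rw [Set.uIcc_of_le hxy.le]
    exact ContinuousOn.div (by fun_prop) hφ'.continuousOn fun t ht => (hpos t ht).ne'
  set l := (V y - V x) / φ y with hl
  have i1 : IntervalIntegrable (fun t => 2 * l * V' t) volume x y :=
    Continuous.intervalIntegrable (by fun_prop) _ _
  have i3 : IntervalIntegrable (fun t => l ^ 2 * φ' t) volume x y :=
    Continuous.intervalIntegrable (by fun_prop) _ _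
  have h : ∫ t in x..y, 2 * l * V' t ≤ ∫ t in x..y, (V' t ^ 2 / φ' t + l ^ 2 * φ' t) := by
    refine intervalIntegral.integral_mono_on hxy.le i1 (hcW.intervalIntegrable.add i3) ?_
    intro t ht
    have hp := hpos t ht
    have : V' t ^ 2 / φ' t + l ^ 2 * φ' t - 2 * l * V' t = (V' t - l * φ' t) ^ 2 / φ' t := by
      field_simp; ring
    have h2 : 0 ≤ (V' t - l * φ' t) ^ 2 / φ' t := by positivity
    linarith
  rw [intervalIntegral.integral_add hcW.intervalIntegrable i3, intervalIntegral.integral_const_mul,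
    intervalIntegral.integral_const_mul, intervalIntegral.integral_eq_sub_of_hasDerivAt
      (fun t _ => hV t) (hV'.intervalIntegrable _ _), intervalIntegral.integral_eq_sub_of_hasDerivAt
      (fun t _ => hφ t) (hφ'.intervalIntegrable _ _), hφ0] at h
  have e : V y - V x = l * φ y := by rw [hl]; field_simp
  rw [e] at h ⊢
  nlinarith

open scoped ENNReal in
lemma pw_half {p V V' : ℝ → ℝ} {k b R x₀ : ℝ} (hp0 : ∀ x, 0 ≤ p x) (hpm : Measurable p)
    (hpi : Integrable p) (hkR : k * R = Real.pi / 2) (hk : 0 < k)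
    (hqc : ∀ x z y, x ≤ z → z ≤ y → min (p x * Real.exp (-(2 * b * x))) (p y * Real.exp (-(2 * b * y)))
      ≤ p z * Real.exp (-(2 * b * z)))
    (hM : ∫ x in (-R)..R, pwphi k b x * p x = 0) (hu1 : -R < x₀)
    (hx₀ : pwphi k b x₀ = 0) (hV : ∀ t, HasDerivAt V (V' t) t) (hV' : Continuous V') :
    ∫⁻ y in Set.Ioo x₀ R, ENNReal.ofReal ((V y - V x₀) ^ 2 * p y) ≤
      ∫⁻ y in Set.Ioo x₀ R, ENNReal.ofReal (V' y ^ 2 * p y / (k ^ 2 + b ^ 2)) := by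
  set μ := k ^ 2 + b ^ 2 with hμ
  have hμ0 : 0 < μ := by positivity
  set φ' : ℝ → ℝ := fun x => μ * (Real.exp (-(b * x)) * Real.cos (k * x)) with hφ'
  have hφ'c : Continuous φ' := by simp only [hφ']; fun_prop
  have hφd : ∀ x, HasDerivAt (pwphi k b) (φ' x) x := pwphi_deriv k b
  have hcos : ∀ x, -R < x → x < R → 0 < Real.cos (k * x) := by
    intro x h1 h2
    refine Real.cos_pos_of_mem_Ioo ⟨?_, ?_⟩
    · have := mul_lt_mul_of_pos_left h1 hk; linarith
    · have := mul_lt_mul_of_pos_left h2 hk; linarith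
  have hφ'0 : ∀ x, -R < x → x < R → 0 < φ' x := fun x h1 h2 =>
    mul_pos hμ0 (mul_pos (Real.exp_pos _) (hcos x h1 h2))
  have hφpos : ∀ y, x₀ < y → y < R → 0 < pwphi k b y := by
    intro y h1 h2
    obtain ⟨c, hc, e⟩ := exists_hasDerivAt_eq_slope (pwphi k b) φ' h1
      (pwphi_cont k b).continuousOn (fun x _ => hφd x)
    have := hφ'0 c (hu1.trans hc.1) (hc.2.trans h2)
    rw [e, hx₀, sub_zero] at this
    exact (div_pos_iff_of_pos_right (by linarith)).1 this
  set W : ℝ → ℝ := fun t => V' t ^ 2 / φ' t with hW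
  have hWm : Measurable W := (by fun_prop : Measurable fun t => V' t ^ 2).div hφ'c.measurable
  have hφm : Measurable (pwphi k b) := (pwphi_cont k b).measurable
  calc ∫⁻ y in Set.Ioo x₀ R, ENNReal.ofReal ((V y - V x₀) ^ 2 * p y)
      ≤ ∫⁻ y in Set.Ioo x₀ R, ∫⁻ t in Set.Ioo x₀ R,
          (if t < y then ENNReal.ofReal (pwphi k b y * p y) * ENNReal.ofReal (W t) else 0) := by
        refine setLIntegral_mono' measurableSet_Ioo ?_
        intro y hy
        have hW0 : ∀ t ∈ Set.Ioc x₀ y, 0 ≤ W t := fun t ht =>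
          div_nonneg (sq_nonneg _) (hφ'0 t (hu1.trans ht.1) (ht.2.trans_lt hy.2)).le
        have h1 : (fun t => if t < y then ENNReal.ofReal (pwphi k b y * p y) * ENNReal.ofReal (W t) else 0)
          = Set.indicator (Set.Iio y) (fun t => ENNReal.ofReal (pwphi k b y * p y) * ENNReal.ofReal (W t)) := by
          ext t; simp [Set.indicator]
        have h2 : Set.Iio y ∩ Set.Ioo x₀ R = Set.Ioo x₀ y := by
          ext t; simp only [Set.mem_inter_iff, Set.mem_Iio, Set.mem_Ioo]
          constructor
          · rintro ⟨a, b, c⟩; exact ⟨b, a⟩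
          · rintro ⟨a, b⟩; exact ⟨b, a, b.trans hy.2⟩
        rw [h1, setLIntegral_indicator measurableSet_Iio, h2,
          lintegral_const_mul _ hWm.ennreal_ofReal, setLIntegral_congr Ioo_ae_eq_Ioc]
        have hWi : IntegrableOn W (Set.Ioc x₀ y) := by
          rw [← intervalIntegrable_iff_integrableOn_Ioc_of_le hy.1.le]
          apply ContinuousOn.intervalIntegrable
          rw [Set.uIcc_of_le hy.1.le]
          exact ContinuousOn.div (by fun_prop) hφ'c.continuousOn fun t ht =>
            (hφ'0 t (hu1.trans_le ht.1) (ht.2.trans_lt hy.2)).ne'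
        rw [← ofReal_integral_eq_lintegral_ofReal hWi
          ((ae_restrict_iff' measurableSet_Ioc).2 (Filter.Eventually.of_forall hW0)),
          ← ENNReal.ofReal_mul (mul_nonneg (hφpos y hy.1 hy.2).le (hp0 y)),
          ← intervalIntegral.integral_of_le hy.1.le]
        apply ENNReal.ofReal_le_ofReal
        have := pw_cs hy.1 hV hV' hφd hφ'c (fun t ht => hφ'0 t (hu1.trans_le ht.1) (ht.2.trans_lt hy.2))
          hx₀ (hφpos y hy.1 hy.2)
        have h3 := mul_le_mul_of_nonneg_right this (hp0 y)
        refine h3.trans (le_of_eq ?_)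
        simp only [hW]; ring
    _ = ∫⁻ t in Set.Ioo x₀ R, ∫⁻ y in Set.Ioo x₀ R,
          (if t < y then ENNReal.ofReal (pwphi k b y * p y) * ENNReal.ofReal (W t) else 0) := by
        apply lintegral_lintegral_swap
        apply Measurable.aemeasurable
        refine Measurable.ite (measurableSet_lt measurable_snd measurable_fst) ?_ measurable_const
        exact (((hφm.mul hpm).comp measurable_fst).ennreal_ofReal).mul
          (hWm.comp measurable_snd).ennreal_ofReal
    _ ≤ _ := by
        refine setLIntegral_mono' measurableSet_Ioo ?_
        intro t ht
        have h1 : (fun y => if t < y then ENNReal.ofReal (pwphi k b y * p y) * ENNReal.ofReal (W t) else 0)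
          = Set.indicator (Set.Ioi t) (fun y => ENNReal.ofReal (pwphi k b y * p y) * ENNReal.ofReal (W t)) := by
          ext t; simp [Set.indicator]
        have h2 : Set.Ioi t ∩ Set.Ioo x₀ R = Set.Ioo t R := by
          ext y; simp only [Set.mem_inter_iff, Set.mem_Ioi, Set.mem_Ioo]
          constructor
          · rintro ⟨a, b, c⟩; exact ⟨a, c⟩
          · rintro ⟨a, b⟩; exact ⟨a, ht.1.trans a, b⟩
        rw [h1, setLIntegral_indicator measurableSet_Ioi, h2,
          lintegral_mul_const _ (by fun_prop)]
        have hi : IntegrableOn (fun y => pwphi k b y * p y) (Set.Ioo t R) := by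
          have : IntervalIntegrable (fun x => pwphi k b x * p x) volume t R :=
            (hpi.intervalIntegrable).continuousOn_mul (pwphi_cont k b).continuousOn
          rw [intervalIntegrable_iff_integrableOn_Ioc_of_le ht.2.le] at this
          exact this.mono_set Set.Ioo_subset_Ioc_self
        rw [← ofReal_integral_eq_lintegral_ofReal hi
          ((ae_restrict_iff' measurableSet_Ioo).2 (Filter.Eventually.of_forall fun y hy =>
            mul_nonneg (hφpos y (ht.1.trans hy.1) hy.2).le (hp0 y))),
          ← integral_Ioc_eq_integral_Ioo, ← intervalIntegral.integral_of_le ht.2.le]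
        have hT := pw_tail hp0 hpm hpi hkR hk hqc hM (hu1.trans ht.1) ht.2
        have hpt := hφ'0 t (hu1.trans ht.1) ht.2
        have hW0 : 0 ≤ W t := div_nonneg (sq_nonneg _) hpt.le
        rw [← ENNReal.ofReal_mul' hW0]
        apply ENNReal.ofReal_le_ofReal
        refine (mul_le_mul_of_nonneg_right hT hW0).trans (le_of_eq ?_)
        have hc := hcos t (hu1.trans ht.1) ht.2
        simp only [hW, hφ']
        have he := Real.exp_pos (-(b * t))
        generalize Real.cos (k * t) = C at hc ⊢
        generalize Real.exp (-(b * t)) = D at he ⊢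
        field_simp

open scoped ENNReal in
lemma pw_1d {p V V' : ℝ → ℝ} {k R l : ℝ} (hp0 : ∀ x, 0 ≤ p x) (hpm : Measurable p)
    (hpi : Integrable p) (hkR : k * R = Real.pi / 2) (hk : 0 < k) (hl0 : 0 ≤ l) (hlR : l < R)
    (hsupp : ∀ x, l < |x| → p x = 0)
    (hlc : ∀ s x y, 0 < s → s < 1 → p x ^ (1 - s) * p y ^ s ≤ p ((1 - s) * x + s * y))
    (hV : ∀ t, HasDerivAt V (V' t) t) (hV' : Continuous V') :
    ∃ c, ∫⁻ y, ENNReal.ofReal ((V y - c) ^ 2 * p y) ≤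
      ∫⁻ y, ENNReal.ofReal (V' y ^ 2 * p y / k ^ 2) := by
  have hR : 0 < R := hl0.trans_lt hlR
  have hqc : ∀ b x z y : ℝ, x ≤ z → z ≤ y →
      min (p x * Real.exp (-(2 * b * x))) (p y * Real.exp (-(2 * b * y)))
      ≤ p z * Real.exp (-(2 * b * z)) := by
    intro b x z y hxz hzy
    rcases hxz.eq_or_lt with rfl | hxz
    · exact min_le_left _ _
    rcases hzy.eq_or_lt with rfl | hzy
    · exact min_le_right _ _
    have hxy : 0 < y - x := by linarith
    set s := (z - x) / (y - x) with hs
    have hs0 : 0 < s := div_pos (by linarith) hxy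
    have hs1 : s < 1 := (div_lt_one hxy).2 (by linarith)
    have hz : z = (1 - s) * x + s * y := by rw [hs]; field_simp; ring
    have h := hlc s x y hs0 hs1
    rw [← hz] at h
    set A := p x * Real.exp (-(2 * b * x))
    set B := p y * Real.exp (-(2 * b * y))
    have hA : 0 ≤ A := mul_nonneg (hp0 x) (Real.exp_pos _).le
    have hB : 0 ≤ B := mul_nonneg (hp0 y) (Real.exp_pos _).le
    have hm : 0 ≤ min A B := le_min hA hB
    calc min A B = min A B ^ (1 - s) * min A B ^ s := by
          rw [← Real.rpow_add_of_nonneg hm (by linarith) hs0.le]; simp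
      _ ≤ A ^ (1 - s) * B ^ s := by
          refine mul_le_mul (Real.rpow_le_rpow hm (min_le_left _ _) (by linarith))
            (Real.rpow_le_rpow hm (min_le_right _ _) hs0.le) (Real.rpow_nonneg hm _)
            (Real.rpow_nonneg hA _)
      _ = (p x ^ (1 - s) * p y ^ s) * Real.exp (-(2 * b * z)) := by
          rw [Real.mul_rpow (hp0 x) (Real.exp_pos _).le, Real.mul_rpow (hp0 y) (Real.exp_pos _).le,
            ← Real.exp_mul, ← Real.exp_mul]
          have : Real.exp (-(2 * b * z)) = Real.exp (-(2 * b * x) * (1 - s)) * Real.exp (-(2 * b * y) * s) := by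
            rw [← Real.exp_add, hz]; congr 1; ring
          rw [this]; ring
      _ ≤ _ := mul_le_mul_of_nonneg_right h (Real.exp_pos _).le
  have hm0 : 0 < Real.cos (k * l) := by
    refine Real.cos_pos_of_mem_Ioo ⟨?_, ?_⟩
    · have := mul_nonneg hk.le hl0; linarith [Real.pi_pos]
    · have := mul_lt_mul_of_pos_left hlR hk; linarith
  have hcosl : ∀ x, |x| ≤ l → Real.cos (k * l) ≤ Real.cos (k * x) := by
    intro x hx
    rw [← Real.cos_abs (k * x), abs_mul, abs_of_pos hk]
    apply Real.cos_le_cos_of_nonneg_of_le_pi (by positivity)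
    · have := mul_lt_mul_of_pos_left hlR hk; linarith [Real.pi_pos]
    · exact mul_le_mul_of_nonneg_left hx hk.le
  set b₀ := k / Real.cos (k * l) with hb₀
  have hb₀0 : 0 < b₀ := div_pos hk hm0
  have hsgn : ∀ x, |x| ≤ l → k * |Real.sin (k * x)| ≤ b₀ * Real.cos (k * x) := by
    intro x hx
    calc k * |Real.sin (k * x)| ≤ k * 1 := mul_le_mul_of_nonneg_left (Real.abs_sin_le_one _) hk.le
      _ = b₀ * Real.cos (k * l) := by rw [hb₀]; field_simp
      _ ≤ _ := mul_le_mul_of_nonneg_left (hcosl x hx) hb₀0.le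
  set M : ℝ → ℝ := fun b => ∫ x in (-R)..R, pwphi k b x * p x with hMdef
  have hMc : ContinuousOn M (Set.Icc (-b₀) b₀) := by
    obtain ⟨C, hC⟩ := ((isCompact_Icc (a := -b₀) (b := b₀)).prod
      (isCompact_Icc (a := -R) (b := R))).exists_bound_of_continuousOn
      (f := fun z : ℝ × ℝ => pwphi k z.1 z.2) (by unfold pwphi; fun_prop)
    have hle : -R ≤ R := by linarith
    simp only [hMdef, intervalIntegral.integral_of_le hle]
    refine continuousOn_of_dominated (bound := fun x => C * p x) ?_ ?_ ?_ ?_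
    · intro b hb
      exact ((pwphi_cont k b).measurable.mul hpm).aestronglyMeasurable
    · intro b hb
      refine (ae_restrict_iff' measurableSet_Ioc).2 (Filter.Eventually.of_forall fun x hx => ?_)
      rw [norm_mul, Real.norm_of_nonneg (hp0 x)]
      exact mul_le_mul_of_nonneg_right (hC (b, x) ⟨hb, hx.1.le, hx.2⟩) (hp0 x)
    · exact (hpi.const_mul C).integrableOn
    · refine Filter.Eventually.of_forall fun x => Continuous.continuousOn ?_
      unfold pwphi; fun_prop
  have hM1 : M b₀ ≤ 0 := by
    rw [← neg_nonneg, hMdef]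
    simp only []
    rw [← intervalIntegral.integral_neg]
    refine intervalIntegral.integral_nonneg (by linarith) fun x _ => neg_nonneg.2 ?_
    by_cases hx : |x| ≤ l
    · refine mul_nonpos_of_nonpos_of_nonneg ?_ (hp0 x)
      refine mul_nonpos_of_nonneg_of_nonpos (Real.exp_pos _).le ?_
      have h1 := hsgn x hx
      have h2 := mul_le_mul_of_nonneg_left (le_abs_self (Real.sin (k * x))) hk.le
      linarith
    · rw [hsupp x (not_le.1 hx), mul_zero]
  have hM2 : 0 ≤ M (-b₀) := by
    refine intervalIntegral.integral_nonneg (by linarith) fun x _ => ?_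
    by_cases hx : |x| ≤ l
    · refine mul_nonneg ?_ (hp0 x)
      refine mul_nonneg (Real.exp_pos _).le ?_
      have h1 := hsgn x hx
      have h2 := mul_le_mul_of_nonneg_left (neg_abs_le (Real.sin (k * x))) hk.le
      linarith
    · rw [hsupp x (not_le.1 hx), mul_zero]
  obtain ⟨b, -, hMb⟩ := intermediate_value_Icc' (by linarith) hMc ⟨hM1, hM2⟩
  set x₀ := Real.arctan (b / k) / k with hx₀
  have hkx : k * x₀ = Real.arctan (b / k) := by rw [hx₀]; field_simp
  have hφ0 : pwphi k b x₀ = 0 := by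
    unfold pwphi
    have hc := Real.cos_arctan_pos (b / k)
    have ht := Real.tan_arctan (b / k)
    rw [Real.tan_eq_sin_div_cos] at ht
    rw [hkx]
    have : k * Real.sin (Real.arctan (b / k)) - b * Real.cos (Real.arctan (b / k)) = 0 := by
      field_simp at ht
      linarith
    rw [this, mul_zero]
  have hx1 : -R < x₀ := by
    have := Real.neg_pi_div_two_lt_arctan (b / k)
    rw [← hkx, ← hkR, ← mul_neg] at this
    exact lt_of_mul_lt_mul_left this hk.le
  have hx2 : x₀ < R := by
    have := Real.arctan_lt_pi_div_two (b / k)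
    rw [← hkx, ← hkR] at this
    exact lt_of_mul_lt_mul_left this hk.le
  have right := pw_half hp0 hpm hpi hkR hk (hqc b) hMb hx1 hφ0 hV hV'
  have left := pw_half (p := fun x => p (-x)) (V := fun x => V (-x)) (V' := fun x => -V' (-x))
    (b := -b) (x₀ := -x₀) (fun x => hp0 _) (hpm.comp measurable_neg) hpi.comp_neg hkR hk
    (fun x z y hxz hzy => by
      have := hqc b (-y) (-z) (-x) (by linarith) (by linarith)
      rw [min_comm] at this
      simpa using this)
    (by
      have : ∀ x, pwphi k (-b) x * p (-x) = -(pwphi k b (-x) * p (-x)) := by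
        intro x
        have := pwphi_neg k b (-x)
        rw [neg_neg] at this; rw [this]; ring
      simp only [this, intervalIntegral.integral_neg]
      rw [intervalIntegral.integral_comp_neg (fun x => pwphi k b x * p x), neg_neg]
      simpa using hMb)
    (by linarith) (by rw [pwphi_neg, hφ0, neg_zero])
    (fun t => by
      have := (hV (-t)).comp t (hasDerivAt_neg t)
      simpa [Function.comp_def] using this) (by fun_prop)
  simp only [neg_neg, neg_sq] at left
  have hrefl : ∀ F : ℝ → ℝ≥0∞, ∫⁻ y in Set.Ioo (-x₀) R, F (-y) = ∫⁻ y in Set.Ioo (-R) x₀, F y := by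
    intro F
    have := (Measure.measurePreserving_neg (volume : Measure ℝ)).setLIntegral_comp_preimage_emb
      (MeasurableEquiv.neg ℝ).measurableEmbedding F (Set.Ioo (-R) x₀)
    rw [← this]
    simp
  rw [hrefl (fun y => ENNReal.ofReal ((V y - V x₀) ^ 2 * p y)),
    hrefl (fun y => ENNReal.ofReal (V' y ^ 2 * p y / (k ^ 2 + b ^ 2)))] at left
  refine ⟨V x₀, ?_⟩
  have hsplit : ∀ F : ℝ → ℝ≥0∞, (∀ x, p x = 0 → F x = 0) → ∫⁻ y, F y =
      (∫⁻ y in Set.Ioo (-R) x₀, F y) + ∫⁻ y in Set.Ioo x₀ R, F y := by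
    intro F hF
    have h1 : ∫⁻ y, F y = ∫⁻ y in Set.Ioo (-R) R, F y := by
      symm
      apply setLIntegral_eq_of_support_subset
      intro x hx
      by_contra hcon
      refine hx (hF x (hsupp x ?_))
      by_contra h
      have := abs_le.1 (not_lt.1 h)
      exact hcon ⟨by linarith, by linarith⟩
    have h2 : Set.Ioo (-R) R =ᵐ[volume] (Set.Ioo (-R) x₀ ∪ Set.Ioo x₀ R : Set ℝ) := by
      have : Set.Ioo (-R) R = Set.Ioo (-R) x₀ ∪ Set.Ico x₀ R := (Set.Ioo_union_Ico_eq_Ioo hx1 hx2.le).symm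
      rw [this]
      exact Filter.EventuallyEq.rfl.union Ioo_ae_eq_Ico.symm
    rw [h1, setLIntegral_congr h2, lintegral_union measurableSet_Ioo]
    rw [Set.disjoint_left]
    intro x hx hx'
    exact lt_asymm hx.2 hx'.1
  rw [hsplit _ (fun x hx => by simp [hx]), hsplit _ (fun x hx => by simp [hx])]
  have hmono : ∀ y, ENNReal.ofReal (V' y ^ 2 * p y / (k ^ 2 + b ^ 2)) ≤
      ENNReal.ofReal (V' y ^ 2 * p y / k ^ 2) := by
    intro y
    apply ENNReal.ofReal_le_ofReal
    have := hp0 y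
    apply div_le_div_of_nonneg_left (by positivity) (by positivity)
    nlinarith [sq_nonneg b]
  exact add_le_add (left.trans (lintegral_mono hmono)) (right.trans (lintegral_mono hmono))

lemma pw_coords {n : ℕ} (e : EuclideanSpace ℝ (Fin (n + 1))) (he : ‖e‖ = 1) :
    ∃ Ψ : EuclideanSpace ℝ (Fin (n + 1)) ≃ᵐ ℝ × (Fin n → ℝ), MeasurePreserving Ψ volume volume ∧
      (∀ x, (Ψ x).1 = inner ℝ e x) ∧ (∀ x, ‖(Ψ x).2‖ ≤ ‖x‖) ∧
      ∀ (a b : ℝ) x y, Ψ (a • x + b • y) = a • Ψ x + b • Ψ y := by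
  obtain ⟨b, hb⟩ := Orthonormal.exists_orthonormalBasis_extension_of_card_eq (𝕜 := ℝ)
    (E := EuclideanSpace ℝ (Fin (n + 1))) (ι := Fin (n + 1)) (by simp) (v := fun _ => e)
    (s := {0}) (by
      constructor
      · intro i; simpa using he
      · intro i j hij; exact absurd (Subsingleton.elim i j) hij)
  have hb0 : b 0 = e := hb 0 rfl
  set Ψ := (b.measurableEquiv.trans (MeasurableEquiv.toLp 2 (Fin (n + 1) → ℝ)).symm).trans
    (MeasurableEquiv.piFinSuccAbove (fun _ : Fin (n + 1) => ℝ) 0) with hΨ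
  have h1 : ∀ x, (Ψ x).1 = b.repr x 0 := fun x => rfl
  have h2 : ∀ x j, (Ψ x).2 j = b.repr x j.succ := fun x j => rfl
  refine ⟨Ψ, ?_, ?_, ?_, ?_⟩
  · have m1 : MeasurePreserving b.measurableEquiv volume volume := b.measurePreserving_measurableEquiv
    have m2 := EuclideanSpace.volume_preserving_symm_measurableEquiv_toLp (Fin (n + 1))
    have m3 := volume_preserving_piFinSuccAbove (fun _ : Fin (n + 1) => ℝ) 0
    exact (m3.comp m2).comp m1
  · intro x; rw [h1, b.repr_apply_apply, hb0]
  · intro x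
    refine (pi_norm_le_iff_of_nonneg (norm_nonneg _)).2 fun j => ?_
    rw [h2, ← b.repr.norm_map x]
    exact PiLp.norm_apply_le _ _
  · intro a c x y
    refine Prod.ext ?_ ?_
    · simp [h1]
    · ext j; simp [h2]

open scoped ENNReal in
lemma pw_needle {n : ℕ} {K : Set (EuclideanSpace ℝ (Fin (n + 1)))} (hKc : Convex ℝ K)
    (hKm : MeasurableSet K) (hKb : Bornology.IsBounded K) {L : ℝ} (hL : Metric.diam K < L)
    {e : EuclideanSpace ℝ (Fin (n + 1))} (he : ‖e‖ = 1) {V V' : ℝ → ℝ}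
    (hV : ∀ t, HasDerivAt V (V' t) t) (hV' : Continuous V') :
    ∃ c : ℝ, ∫⁻ x in K, ENNReal.ofReal ((V (inner ℝ e x) - c) ^ 2) ≤
      ∫⁻ x in K, ENNReal.ofReal ((L / Real.pi) ^ 2 * V' (inner ℝ e x) ^ 2) := by
  rcases K.eq_empty_or_nonempty with rfl | hKn
  · exact ⟨0, by simp⟩
  obtain ⟨Ψ, hmp, h1, h2, hlin⟩ := pw_coords e he
  have hL0 : 0 < L := Metric.diam_nonneg.trans_lt hL
  set S : Set (ℝ × (Fin n → ℝ)) := Ψ.symm ⁻¹' K with hS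
  have hSm : MeasurableSet S := Ψ.symm.measurable hKm
  have hSc : ∀ z ∈ S, ∀ w ∈ S, ∀ s : ℝ, 0 < s → s < 1 → (1 - s) • z + s • w ∈ S := by
    intro z hz w hw s hs0 hs1
    have : (1 - s) • z + s • w = Ψ ((1 - s) • Ψ.symm z + s • Ψ.symm w) := by
      rw [hlin]; simp
    rw [this, hS, Set.mem_preimage, MeasurableEquiv.symm_apply_apply]
    exact hKc hz hw (by linarith) hs0.le (by ring)
  obtain ⟨C, hC⟩ := hKb.exists_norm_le
  set P : ℝ → ℝ≥0∞ := fun t => volume (Prod.mk t ⁻¹' S) with hP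
  have hPm : Measurable P := measurable_measure_prodMk_left hSm
  have hPt : ∀ t, P t ≠ ∞ := by
    intro t
    refine ((measure_mono (t := Metric.closedBall 0 C) ?_).trans_lt measure_closedBall_lt_top).ne
    intro y hy
    have := h2 (Ψ.symm (t, y))
    rw [MeasurableEquiv.apply_symm_apply] at this
    simpa using this.trans (hC _ hy)
  have hfub : ∀ G : ℝ → ℝ≥0∞, Measurable G →
      ∫⁻ x in K, G (inner ℝ e x) = ∫⁻ t, G t * P t := by
    intro G hG
    have e1 : ∫⁻ x in K, G (inner ℝ e x) = ∫⁻ z in S, G z.1 := by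
      rw [← hmp.setLIntegral_comp_preimage_emb Ψ.measurableEmbedding]
      have : Ψ ⁻¹' S = K := by ext x; simp [hS]
      rw [this]
      simp only [h1]
    rw [e1, ← lintegral_indicator hSm, Measure.volume_eq_prod,
      lintegral_prod (S.indicator fun z : ℝ × (Fin n → ℝ) => G z.1)
        ((hG.comp measurable_fst).indicator hSm).aemeasurable]
    refine lintegral_congr fun t => ?_
    have : ∀ y, S.indicator (fun z : ℝ × (Fin n → ℝ) => G z.1) (t, y) =
        (Prod.mk t ⁻¹' S).indicator (fun _ => G t) y := fun y => rfl
    simp only [this]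
    rw [lintegral_indicator_const (measurable_prodMk_left hSm)]
  have hPint : ∫⁻ t, P t ≠ ∞ := by
    have := hfub (fun _ => 1) measurable_const
    simp only [one_mul, lintegral_const, Measure.restrict_apply_univ] at this
    rw [← this]
    exact hKb.measure_lt_top.ne
  set p : ℝ → ℝ := fun t => (P t).toReal with hp
  have hlc : ∀ s x y, 0 < s → s < 1 → p x ^ (1 - s) * p y ^ s ≤ p ((1 - s) * x + s * y) := by
    intro s x y hs0 hs1
    have hs1' : 0 < 1 - s := by linarith
    simp only [hp, ENNReal.toReal_rpow, ← ENNReal.toReal_mul]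
    refine ENNReal.toReal_mono (hPt _) ?_
    have hm : ∀ t, MeasurableSet (Prod.mk t ⁻¹' S) := fun t => measurable_prodMk_left hSm
    have := pw_pl hs0 hs1 n (f := (Prod.mk x ⁻¹' S).indicator 1) (g := (Prod.mk y ⁻¹' S).indicator 1)
      (h := (Prod.mk ((1 - s) * x + s * y) ⁻¹' S).indicator 1)
      (measurable_one.indicator (hm _)) (measurable_one.indicator (hm _))
      (measurable_one.indicator (hm _)) (by
        intro a b
        by_cases ha : a ∈ Prod.mk x ⁻¹' S
        · by_cases hb : b ∈ Prod.mk y ⁻¹' S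
          · have : (1 - s) • a + s • b ∈ Prod.mk ((1 - s) * x + s * y) ⁻¹' S :=
              hSc _ ha _ hb s hs0 hs1
            simp [Set.indicator_of_mem ha, Set.indicator_of_mem hb, Set.indicator_of_mem this]
          · simp [Set.indicator_of_notMem hb, hs0]
        · simp [Set.indicator_of_notMem ha, hs1'])
    simpa [lintegral_indicator_one, hm] using this
  -- the support
  set I := (fun x => inner ℝ e x) '' K with hI
  have hLip : LipschitzWith 1 (fun x : EuclideanSpace ℝ (Fin (n + 1)) => (inner ℝ e x : ℝ)) := by
    refine LipschitzWith.of_dist_le_mul fun x y => ?_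
    rw [Real.dist_eq, ← inner_sub_right, dist_eq_norm]
    have := abs_real_inner_le_norm e (x - y)
    rw [he] at this
    simpa using this
  have hIb : Bornology.IsBounded I := hLip.isBounded_image hKb
  have hIn : I.Nonempty := hKn.image _
  have hId : Metric.diam I ≤ Metric.diam K := by
    simpa using hLip.diam_image_le K hKb
  rw [Real.diam_eq hIb] at hId
  have hle : sInf I ≤ sSup I := by
    obtain ⟨y, hy⟩ := hIn
    exact (csInf_le hIb.bddBelow hy).trans (le_csSup hIb.bddAbove hy)
  set m := (sSup I + sInf I) / 2
  have hsupp : ∀ x, (sSup I - sInf I) / 2 < |x| → p (x + m) = 0 := by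
    intro x hx
    have : Prod.mk (x + m) ⁻¹' S = ∅ := by
      rw [Set.eq_empty_iff_forall_notMem]
      intro y hy
      have hmem : x + m ∈ I := by
        refine ⟨Ψ.symm (x + m, y), hy, ?_⟩
        change inner ℝ e (Ψ.symm (x + m, y)) = x + m
        rw [← h1]; simp
      have a1 := csInf_le hIb.bddBelow hmem
      have a2 := le_csSup hIb.bddAbove hmem
      rcases lt_abs.1 hx with h | h <;> simp only [m] at a1 a2 <;> linarith
    simp [hp, hP, this]
  have hpm : Measurable p := hPm.ennreal_toReal
  have hpi : Integrable p := integrable_toReal_of_lintegral_ne_top hPm.aemeasurable hPint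
  have hpi_pos := Real.pi_pos
  obtain ⟨c, hc⟩ := pw_1d (p := fun x => p (x + m)) (V := fun x => V (x + m))
    (V' := fun x => V' (x + m)) (k := Real.pi / L) (R := L / 2) (l := (sSup I - sInf I) / 2)
    (fun x => ENNReal.toReal_nonneg) (hpm.comp (measurable_add_const m)) (hpi.comp_add_right m)
    (by field_simp) (by positivity) (by linarith) (by linarith) hsupp
    (fun s x y hs0 hs1 => by
      have := hlc s (x + m) (y + m) hs0 hs1
      refine this.trans (le_of_eq ?_)
      congr 1; ring)
    (fun t => by simpa using (hV (t + m)).comp_add_const t m)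
    (by fun_prop)
  refine ⟨c, ?_⟩
  have hVc : Continuous V := continuous_iff_continuousAt.2 fun t => (hV t).continuousAt
  rw [lintegral_add_right_eq_self (fun y => ENNReal.ofReal ((V y - c) ^ 2 * p y)) m,
    lintegral_add_right_eq_self (fun y => ENNReal.ofReal (V' y ^ 2 * p y / (Real.pi / L) ^ 2)) m] at hc
  rw [hfub (fun t => ENNReal.ofReal ((V t - c) ^ 2)) (by fun_prop),
    hfub (fun t => ENNReal.ofReal ((L / Real.pi) ^ 2 * V' t ^ 2)) (by fun_prop)]
  have hPp : ∀ t, P t = ENNReal.ofReal (p t) := fun t => (ENNReal.ofReal_toReal (hPt t)).symm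
  calc _ = ∫⁻ y, ENNReal.ofReal ((V y - c) ^ 2 * p y) := by
        refine lintegral_congr fun y => ?_
        rw [hPp, ENNReal.ofReal_mul (sq_nonneg _)]
    _ ≤ _ := hc
    _ = _ := by
        refine lintegral_congr fun y => ?_
        rw [hPp, ← ENNReal.ofReal_mul (by positivity)]
        congr 1
        field_simp

lemma pw_null {d : ℕ} {i j : Fin d} (hij : i ≠ j) (c₁ c₂ θ : ℝ) :
    volume {x : EuclideanSpace ℝ (Fin d) | Real.cos θ * (x i - c₁) + Real.sin θ * (x j - c₂) = 0} = 0 := by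
  set ℓ : EuclideanSpace ℝ (Fin d) →ₗ[ℝ] ℝ :=
    Real.cos θ • (EuclideanSpace.proj i : EuclideanSpace ℝ (Fin d) →L[ℝ] ℝ).toLinearMap +
    Real.sin θ • (EuclideanSpace.proj j : EuclideanSpace ℝ (Fin d) →L[ℝ] ℝ).toLinearMap with hℓ
  have hℓa : ∀ x, ℓ x = Real.cos θ * x i + Real.sin θ * x j := fun x => by simp [hℓ]
  set w : EuclideanSpace ℝ (Fin d) := EuclideanSpace.single i c₁ + EuclideanSpace.single j c₂ with hw
  have hw1 : w i = c₁ := by simp [hw, hij]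
  have hw2 : w j = c₂ := by simp [hw, hij.symm]
  have hker : LinearMap.ker ℓ ≠ ⊤ := by
    intro h
    have h0 : ∀ x, ℓ x = 0 := fun x => LinearMap.mem_ker.1 (h ▸ Submodule.mem_top)
    have a1 := h0 (EuclideanSpace.single i 1)
    have a2 := h0 (EuclideanSpace.single j 1)
    simp [hℓa, hij, hij.symm] at a1 a2
    have := Real.sin_sq_add_cos_sq θ
    rw [a1, a2] at this
    norm_num at this
  have hnull := Measure.addHaar_submodule (volume : Measure (EuclideanSpace ℝ (Fin d))) _ hker
  have : {x : EuclideanSpace ℝ (Fin d) | Real.cos θ * (x i - c₁) + Real.sin θ * (x j - c₂) = 0} =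
      (fun x => x + (-w)) ⁻¹' (LinearMap.ker ℓ : Set (EuclideanSpace ℝ (Fin d))) := by
    ext x
    simp only [Set.mem_setOf_eq, Set.mem_preimage, SetLike.mem_coe, LinearMap.mem_ker, hℓa]
    simp [hw1, hw2, sub_eq_add_neg]
  rw [this, measure_preimage_add_right]
  exact hnull

/-- bisecting a set by a hyperplane through a given codimension two affine space -/
lemma pw_bisect {d : ℕ} {i j : Fin d} (hij : i ≠ j) (c₁ c₂ : ℝ)
    {K : Set (EuclideanSpace ℝ (Fin d))} (hK : MeasurableSet K)
    {v F : EuclideanSpace ℝ (Fin d) → ℝ} (hv : IntegrableOn v K) (hF : IntegrableOn F K)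
    (hv0 : ∫ x in K, v x = 0) (hF0 : 0 < ∫ x in K, F x) :
    ∃ θ : ℝ, (∫ x in K ∩ {x | 0 ≤ Real.cos θ * (x i - c₁) + Real.sin θ * (x j - c₂)}, v x = 0) ∧
      0 < ∫ x in K ∩ {x | 0 ≤ Real.cos θ * (x i - c₁) + Real.sin θ * (x j - c₂)}, F x := by
  set ℓ : ℝ → EuclideanSpace ℝ (Fin d) → ℝ :=
    fun θ x => Real.cos θ * (x i - c₁) + Real.sin θ * (x j - c₂) with hℓ
  have hℓc : ∀ θ, Continuous (ℓ θ) := fun θ => by simp only [hℓ]; fun_prop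
  have hℓc' : ∀ x, Continuous (fun θ => ℓ θ x) := fun x => by simp only [hℓ]; fun_prop
  have hHm : ∀ θ, MeasurableSet {x | 0 ≤ ℓ θ x} := fun θ =>
    (isClosed_le continuous_const (hℓc θ)).measurableSet
  have hπ : ∀ θ x, ℓ (θ + Real.pi) x = -ℓ θ x := by
    intro θ x; simp only [hℓ, Real.cos_add_pi, Real.sin_add_pi]; ring
  have hsplit : ∀ θ, ∀ u : EuclideanSpace ℝ (Fin d) → ℝ, IntegrableOn u K →
      (∫ x in K ∩ {x | 0 ≤ ℓ θ x}, u x) + ∫ x in K ∩ {x | 0 ≤ ℓ (θ + Real.pi) x}, u x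
        = ∫ x in K, u x := by
    intro θ u hu
    have hd : AEDisjoint volume (K ∩ {x | 0 ≤ ℓ θ x}) (K ∩ {x | 0 ≤ ℓ (θ + Real.pi) x}) := by
      refine measure_mono_null ?_ (pw_null hij c₁ c₂ θ)
      rintro x ⟨⟨-, h1⟩, -, h2⟩
      simp only [Set.mem_setOf_eq, hπ] at h1 h2
      exact le_antisymm (by linarith) h1
    rw [← setIntegral_union₀ hd (hK.inter (hHm _)).nullMeasurableSet
      (hu.mono_set Set.inter_subset_left) (hu.mono_set Set.inter_subset_left)]
    congr 2
    ext x
    simp only [Set.mem_union, Set.mem_inter_iff, Set.mem_setOf_eq, hπ]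
    constructor
    · rintro (h | h) <;> exact h.1
    · intro h
      rcases le_total 0 (ℓ θ x) with h1 | h1
      · exact Or.inl ⟨h, h1⟩
      · exact Or.inr ⟨h, by linarith⟩
  set S : ℝ → ℝ := fun θ => ∫ x in K ∩ {x | 0 ≤ ℓ θ x}, v x with hS
  have hSc : Continuous S := by
    have e : S = fun θ => ∫ x in K, Set.indicator {x | 0 ≤ ℓ θ x} v x := by
      ext θ; simp only [hS]; rw [setIntegral_indicator (hHm θ)]
    rw [e]
    refine continuous_iff_continuousAt.2 fun θ => ?_
    refine continuousAt_of_dominated (bound := fun x => ‖v x‖) ?_ ?_ hv.norm ?_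
    · exact Filter.Eventually.of_forall fun θ => hv.aestronglyMeasurable.indicator (hHm θ)
    · exact Filter.Eventually.of_forall fun θ => Filter.Eventually.of_forall fun x =>
        norm_indicator_le_norm_self _ _
    · refine ae_restrict_of_ae ?_
      have : ∀ᵐ x : EuclideanSpace ℝ (Fin d), ℓ θ x ≠ 0 := by
        rw [ae_iff]; simpa using pw_null hij c₁ c₂ θ
      filter_upwards [this] with x hx
      rcases lt_or_gt_of_ne hx with h | h
      · have hev : ∀ᶠ t in nhds θ, ℓ t x < 0 := (hℓc' x).continuousAt.eventually_lt continuousAt_const h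
        refine (continuousAt_const (y := (0 : ℝ))).congr ?_
        filter_upwards [hev] with t ht
        rw [Set.indicator_of_notMem]; simpa using ht
      · have hev : ∀ᶠ t in nhds θ, 0 < ℓ t x := continuousAt_const.eventually_lt (hℓc' x).continuousAt h
        refine (continuousAt_const (y := v x)).congr ?_
        filter_upwards [hev] with t ht
        rw [Set.indicator_of_mem]; exact ht.le
  have hSπ : ∀ θ, S (θ + Real.pi) = - S θ := by
    intro θ
    have := hsplit θ v hv
    rw [hv0] at this
    simp only [hS]; linarith
  obtain ⟨θ, hθ⟩ : ∃ θ, S θ = 0 := by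
    have h1 := hSπ 0
    rw [zero_add] at h1
    rcases le_total (S 0) 0 with h | h
    · obtain ⟨θ, -, h2⟩ := intermediate_value_Icc Real.pi_pos.le hSc.continuousOn
        (show (0 : ℝ) ∈ Set.Icc (S 0) (S Real.pi) from ⟨h, by linarith⟩)
      exact ⟨θ, h2⟩
    · obtain ⟨θ, -, h2⟩ := intermediate_value_Icc' Real.pi_pos.le hSc.continuousOn
        (show (0 : ℝ) ∈ Set.Icc (S Real.pi) (S 0) from ⟨by linarith, h⟩)
      exact ⟨θ, h2⟩
  have hFs := hsplit θ F hF
  by_cases hpos : 0 < ∫ x in K ∩ {x | 0 ≤ ℓ θ x}, F x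
  · exact ⟨θ, hθ, hpos⟩
  · refine ⟨θ + Real.pi, ?_, ?_⟩
    · have := hSπ θ
      rw [hθ, neg_zero] at this
      exact this
    · change 0 < ∫ x in K ∩ {x | 0 ≤ ℓ (θ + Real.pi) x}, F x
      linarith

lemma pw_line {n : ℕ} {K : Set (EuclideanSpace ℝ (Fin (n + 1)))} (hKn : K.Nonempty)
    (h : ∀ i j : Fin (n + 1), i ≠ j → ∀ c₁ c₂ : ℚ, ∃ θ : ℝ, ∀ x ∈ K,
      0 ≤ Real.cos θ * (x i - c₁) + Real.sin θ * (x j - c₂)) :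
    ∃ w e : EuclideanSpace ℝ (Fin (n + 1)), ‖e‖ = 1 ∧ ∀ x ∈ K, x = w + (inner ℝ e x : ℝ) • e := by
  obtain ⟨x, hx⟩ := hKn
  -- a sufficient form
  suffices hs : ∃ u : EuclideanSpace ℝ (Fin (n + 1)), u ≠ 0 ∧ ∀ z ∈ K, ∃ a : ℝ, z - x = a • u by
    obtain ⟨u, hu, hz⟩ := hs
    have hu' : ‖u‖ ≠ 0 := norm_ne_zero_iff.2 hu
    set e := (‖u‖⁻¹ : ℝ) • u with he
    have hen : ‖e‖ = 1 := by rw [he, norm_smul, norm_inv, norm_norm, inv_mul_cancel₀ hu']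
    have hue : u = ‖u‖ • e := by rw [he, smul_smul, mul_inv_cancel₀ hu', one_smul]
    refine ⟨x - (inner ℝ e x : ℝ) • e, e, hen, fun z hzK => ?_⟩
    obtain ⟨a, ha⟩ := hz z hzK
    have hzx : z = x + (a * ‖u‖) • e := by
      rw [← smul_smul, ← hue, ← ha]; abel
    have hin : (inner ℝ e z : ℝ) = inner ℝ e x + a * ‖u‖ := by
      rw [hzx, inner_add_right, inner_smul_right, real_inner_self_eq_norm_sq, hen]; ring
    rw [hin, add_smul]
    nth_rewrite 1 [hzx]
    abel
  by_cases hsub : ∀ y ∈ K, y = x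
  · refine ⟨EuclideanSpace.single 0 1, by simp, fun z hz => ⟨0, ?_⟩⟩
    rw [hsub z hz]; simp
  push Not at hsub
  obtain ⟨y, hy, hyx⟩ := hsub
  refine ⟨y - x, sub_ne_zero.2 hyx, fun z hz => ?_⟩
  by_contra hcon
  push Not at hcon
  -- a nonvanishing minor
  obtain ⟨i, hi⟩ : ∃ i, y i - x i ≠ 0 := by
    by_contra hc
    push Not at hc
    exact hyx (by ext i; linarith [hc i])
  obtain ⟨j, hj⟩ : ∃ j, z j - x j ≠ ((z i - x i) / (y i - x i)) * (y j - x j) := by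
    by_contra hc
    push Not at hc
    exact hcon ((z i - x i) / (y i - x i)) (by ext j; simpa using hc j)
  have hij : i ≠ j := by
    rintro rfl
    exact hj (by field_simp)
  have hD : (y i - x i) * (z j - x j) - (y j - x j) * (z i - x i) ≠ 0 := by
    intro hD
    apply hj
    field_simp
    linarith
  set D := (y i - x i) * (z j - x j) - (y j - x j) * (z i - x i) with hDdef
  set α : ℝ × ℝ → ℝ := fun c => ((c.1 - x i) * (z j - x j) - (c.2 - x j) * (z i - x i)) / D with hα
  set β : ℝ × ℝ → ℝ := fun c => ((c.2 - x j) * (y i - x i) - (c.1 - x i) * (y j - x j)) / D with hβ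
  have hαc : Continuous α := by simp only [hα]; fun_prop
  have hβc : Continuous β := by simp only [hβ]; fun_prop
  have hopen : IsOpen {c | 0 < α c ∧ 0 < β c ∧ α c + β c < 1} :=
    (isOpen_lt continuous_const hαc).inter ((isOpen_lt continuous_const hβc).inter
      (isOpen_lt (hαc.add hβc) continuous_const))
  have hne : {c | 0 < α c ∧ 0 < β c ∧ α c + β c < 1}.Nonempty := by
    refine ⟨(x i + ((y i - x i) + (z i - x i)) / 3, x j + ((y j - x j) + (z j - x j)) / 3), ?_⟩
    have e1 : α (x i + ((y i - x i) + (z i - x i)) / 3, x j + ((y j - x j) + (z j - x j)) / 3) = 1 / 3 := by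
      simp only [hα]; rw [div_eq_iff hD, hDdef]; ring
    have e2 : β (x i + ((y i - x i) + (z i - x i)) / 3, x j + ((y j - x j) + (z j - x j)) / 3) = 1 / 3 := by
      simp only [hβ]; rw [div_eq_iff hD, hDdef]; ring
    simp only [Set.mem_setOf_eq, e1, e2]; norm_num
  have hdense : DenseRange (Prod.map (fun q : ℚ => (q : ℝ)) (fun q : ℚ => (q : ℝ))) :=
    Rat.denseRange_cast.prodMap Rat.denseRange_cast
  obtain ⟨⟨c₁, c₂⟩, hc1, hc2, hc3⟩ := hdense.exists_mem_open hopen hne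
  simp only [Prod.map] at hc1 hc2 hc3
  set a := α ((c₁ : ℝ), (c₂ : ℝ)) with ha
  set b := β ((c₁ : ℝ), (c₂ : ℝ)) with hb
  have e1 : (c₁ : ℝ) = x i + a * (y i - x i) + b * (z i - x i) := by
    have : a * D = _ := div_mul_cancel₀ _ hD
    have h2 : b * D = _ := div_mul_cancel₀ _ hD
    apply mul_right_cancel₀ hD
    simp only at this h2
    linear_combination (-(y i - x i)) * this - (z i - x i) * h2 + (c₁ - x i) * hDdef
  have e2 : (c₂ : ℝ) = x j + a * (y j - x j) + b * (z j - x j) := by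
    have : a * D = _ := div_mul_cancel₀ _ hD
    have h2 : b * D = _ := div_mul_cancel₀ _ hD
    apply mul_right_cancel₀ hD
    simp only at this h2
    linear_combination (-(y j - x j)) * this - (z j - x j) * h2 + (c₂ - x j) * hDdef
  obtain ⟨θ, hθ⟩ := h i j hij c₁ c₂
  have hX := hθ x hx
  have hY := hθ y hy
  have hZ := hθ z hz
  set A := Real.cos θ
  set B := Real.sin θ
  have hAB : B ^ 2 + A ^ 2 = 1 := Real.sin_sq_add_cos_sq θ
  set X := A * (x i - c₁) + B * (x j - c₂) with hXd
  set Y := A * (y i - c₁) + B * (y j - c₂) with hYd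
  set Z := A * (z i - c₁) + B * (z j - c₂) with hZd
  have hcomb : (1 - a - b) * X + a * Y + b * Z = 0 := by
    rw [hXd, hYd, hZd, e1, e2]; ring
  have p1 : 0 ≤ (1 - a - b) * X := mul_nonneg (by linarith) hX
  have p2 : 0 ≤ a * Y := mul_nonneg hc1.le hY
  have p3 : 0 ≤ b * Z := mul_nonneg hc2.le hZ
  have X0 : X = 0 := (mul_eq_zero.1 (show (1 - a - b) * X = 0 by linarith)).resolve_left (by linarith)
  have Y0 : Y = 0 := (mul_eq_zero.1 (show a * Y = 0 by linarith)).resolve_left hc1.ne'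
  have Z0 : Z = 0 := (mul_eq_zero.1 (show b * Z = 0 by linarith)).resolve_left hc2.ne'
  have q1 : A * (y i - x i) + B * (y j - x j) = 0 := by linarith
  have q2 : A * (z i - x i) + B * (z j - x j) = 0 := by linarith
  have A0 : A * D = 0 := by rw [hDdef]; linear_combination (z j - x j) * q1 - (y j - x j) * q2
  have B0 : B * D = 0 := by rw [hDdef]; linear_combination (y i - x i) * q2 - (z i - x i) * q1
  have A0' := (mul_eq_zero.1 A0).resolve_right hD
  have B0' := (mul_eq_zero.1 B0).resolve_right hD
  rw [A0', B0'] at hAB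
  norm_num at hAB


lemma pw_intOn {n : ℕ} {K : Set (EuclideanSpace ℝ (Fin n))} (hKb : Bornology.IsBounded K)
    {f : EuclideanSpace ℝ (Fin n) → ℝ} (hf : Continuous f) : IntegrableOn f K :=
  (hf.continuousOn.integrableOn_compact (hKb.isCompact_closure)).mono_set subset_closure

lemma pw_local {n : ℕ} {K : Set (EuclideanSpace ℝ (Fin (n + 1)))} (hKc : Convex ℝ K)
    (hKm : MeasurableSet K) (hKb : Bornology.IsBounded K) {L : ℝ} (hL : Metric.diam K < L)
    {w e : EuclideanSpace ℝ (Fin (n + 1))} (he : ‖e‖ = 1)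
    {v : EuclideanSpace ℝ (Fin (n + 1)) → ℝ} (hv : ContDiff ℝ 1 v) (hv0 : ∫ x in K, v x = 0)
    {η : ℝ} (hη0 : 0 ≤ η) (hη1 : η ≤ 1)
    (h1 : ∀ x ∈ K, |v x - v (w + (inner ℝ e x : ℝ) • e)| ≤ η)
    (h2 : ∀ x ∈ K, |v x ^ 2 - v (w + (inner ℝ e x : ℝ) • e) ^ 2| ≤ η)
    (h3 : ∀ x ∈ K, |‖fderiv ℝ v x‖ ^ 2 - ‖fderiv ℝ v (w + (inner ℝ e x : ℝ) • e)‖ ^ 2| ≤ η) :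
    ∫ x in K, v x ^ 2 ≤
      ∫ x in K, ((L / Real.pi) ^ 2 * ‖fderiv ℝ v x‖ ^ 2 + (2 + (L / Real.pi) ^ 2) * η) := by
  have hvc : Continuous v := hv.continuous
  have hfc : Continuous (fderiv ℝ v) := hv.continuous_fderiv (by norm_num)
  have hV : ∀ t : ℝ, HasDerivAt (fun t : ℝ => v (w + t • e)) (fderiv ℝ v (w + t • e) e) t := by
    intro t
    have hd := (hv.differentiable (by norm_num) (w + t • e)).hasFDerivAt
    have hl : HasDerivAt (fun t : ℝ => w + t • e) e t := by
      simpa using ((hasDerivAt_id t).smul_const e).const_add w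
    exact hd.comp_hasDerivAt t hl
  have hV' : Continuous (fun t : ℝ => fderiv ℝ v (w + t • e) e) := by fun_prop
  obtain ⟨c, hc⟩ := pw_needle hKc hKm hKb hL he hV hV'
  have i1 : IntegrableOn (fun x => (v (w + (inner ℝ e x : ℝ) • e) - c) ^ 2) K :=
    pw_intOn hKb (by fun_prop)
  have i2 : IntegrableOn (fun x => (L / Real.pi) ^ 2 *
      (fderiv ℝ v (w + (inner ℝ e x : ℝ) • e) e) ^ 2) K :=
    pw_intOn hKb (by fun_prop)
  have hc' : ∫ x in K, (v (w + (inner ℝ e x : ℝ) • e) - c) ^ 2 ≤ ∫ x in K, (L / Real.pi) ^ 2 *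
      (fderiv ℝ v (w + (inner ℝ e x : ℝ) • e) e) ^ 2 := by
    rw [← ofReal_integral_eq_lintegral_ofReal i1 (Filter.Eventually.of_forall fun x => by positivity),
      ← ofReal_integral_eq_lintegral_ofReal i2 (Filter.Eventually.of_forall fun x => by positivity)] at hc
    exact (ENNReal.ofReal_le_ofReal_iff (integral_nonneg fun x => by positivity)).1 hc
  have iv : IntegrableOn v K := pw_intOn hKb hvc
  have icst : IntegrableOn (fun _ : EuclideanSpace ℝ (Fin (n + 1)) => 2 * η) K :=
    pw_intOn hKb (by fun_prop)
  have s1 : ∫ x in K, v x ^ 2 ≤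
      ∫ x in K, ((v (w + (inner ℝ e x : ℝ) • e) - c) ^ 2 + 2 * η + 2 * c * v x) := by
    refine setIntegral_mono_on (pw_intOn hKb (by fun_prop)) (pw_intOn hKb (by fun_prop)) hKm ?_
    intro x hx
    have a1 := abs_le.1 (h1 x hx)
    have a2 := abs_le.1 (h2 x hx)
    set p := v (w + (inner ℝ e x : ℝ) • e)
    have : (v x - p) ^ 2 ≤ η := by nlinarith
    nlinarith [sq_nonneg (c - (p - v x))]
  have s2 : ∫ x in K, ((v (w + (inner ℝ e x : ℝ) • e) - c) ^ 2 + 2 * η + 2 * c * v x) =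
      (∫ x in K, (v (w + (inner ℝ e x : ℝ) • e) - c) ^ 2) + ∫ x in K, 2 * η := by
    have i12 : IntegrableOn (fun x => (v (w + (inner ℝ e x : ℝ) • e) - c) ^ 2 + 2 * η) K :=
      i1.add icst
    rw [integral_add i12 (iv.const_mul _), integral_add i1 icst, integral_const_mul (2 * c) v, hv0]
    ring
  have s3 : (∫ x in K, (L / Real.pi) ^ 2 *
      (fderiv ℝ v (w + (inner ℝ e x : ℝ) • e) e) ^ 2) + ∫ x in K, 2 * η ≤
      ∫ x in K, ((L / Real.pi) ^ 2 * ‖fderiv ℝ v x‖ ^ 2 + (2 + (L / Real.pi) ^ 2) * η) := by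
    rw [← integral_add i2 icst]
    refine setIntegral_mono_on (i2.add icst) (pw_intOn hKb (by fun_prop)) hKm ?_
    intro x hx
    have a3 := abs_le.1 (h3 x hx)
    set D := fderiv ℝ v (w + (inner ℝ e x : ℝ) • e)
    have hD : (D e) ^ 2 ≤ ‖D‖ ^ 2 := by
      have := D.le_opNorm e
      rw [he, mul_one] at this
      rw [← sq_abs]
      exact pow_le_pow_left₀ (abs_nonneg _) this 2
    have : (L / Real.pi) ^ 2 * (D e) ^ 2 ≤ (L / Real.pi) ^ 2 * (‖fderiv ℝ v x‖ ^ 2 + η) :=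
      mul_le_mul_of_nonneg_left (by linarith) (by positivity)
    linarith
  linarith


lemma pw_core {n : ℕ} {T : Set (EuclideanSpace ℝ (Fin (n + 1)))} (hTc : Convex ℝ T)
    (hTm : MeasurableSet T) (hTb : Bornology.IsBounded T) {L : ℝ} (hL : Metric.diam T < L)
    {v : EuclideanSpace ℝ (Fin (n + 1)) → ℝ} (hv : ContDiff ℝ 1 v) (hv0 : ∫ x in T, v x = 0) :
    ∫ x in T, v x ^ 2 ≤ (L / Real.pi) ^ 2 * ∫ x in T, ‖fderiv ℝ v x‖ ^ 2 := by
  by_contra! hcon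
  have hvc : Continuous v := hv.continuous
  have hfc : Continuous (fderiv ℝ v) := hv.continuous_fderiv (by norm_num)
  set C : ℝ := (L / Real.pi) ^ 2 with hC
  have hC0 : 0 ≤ C := by positivity
  have ivsq : ∀ {K : Set (EuclideanSpace ℝ (Fin (n + 1)))}, K ⊆ T →
      IntegrableOn (fun x => v x ^ 2) K := fun h => pw_intOn (hTb.subset h) (by fun_prop)
  have ifsq : ∀ {K : Set (EuclideanSpace ℝ (Fin (n + 1)))}, K ⊆ T →
      IntegrableOn (fun x => C * ‖fderiv ℝ v x‖ ^ 2) K :=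
    fun h => pw_intOn (hTb.subset h) (by fun_prop)
  have icst : ∀ (a : ℝ) {K : Set (EuclideanSpace ℝ (Fin (n + 1)))}, K ⊆ T →
      IntegrableOn (fun _ => a) K :=
    fun a K h => pw_intOn (hTb.subset h) (by fun_prop)
  obtain ⟨δ, hδ, hFT⟩ : ∃ δ : ℝ, 0 < δ ∧
      0 < ∫ x in T, (v x ^ 2 - C * ‖fderiv ℝ v x‖ ^ 2 - δ) := by
    rw [← integral_const_mul] at hcon
    set M := volume.real T with hM
    have hM0 : 0 ≤ M := measureReal_nonneg
    set g := (∫ x in T, v x ^ 2) - ∫ x in T, C * ‖fderiv ℝ v x‖ ^ 2 with hg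
    have hg0 : 0 < g := by rw [hg]; linarith
    refine ⟨g / (M + 1), by positivity, ?_⟩
    have i3 : IntegrableOn (fun x => v x ^ 2 - C * ‖fderiv ℝ v x‖ ^ 2) T :=
      (ivsq subset_rfl).sub (ifsq subset_rfl)
    rw [integral_sub i3 (icst _ subset_rfl),
      integral_sub (ivsq subset_rfl) (ifsq subset_rfl), setIntegral_const, ← hg, smul_eq_mul, ← hM]
    have : g - M * (g / (M + 1)) = g / (M + 1) := by field_simp; ring
    rw [this]; positivity
  set F : EuclideanSpace ℝ (Fin (n + 1)) → ℝ :=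
    fun x => v x ^ 2 - C * ‖fderiv ℝ v x‖ ^ 2 - δ with hF
  have hFc : Continuous F := by simp only [hF]; fun_prop
  let S := {K : Set (EuclideanSpace ℝ (Fin (n + 1))) // Convex ℝ K ∧ MeasurableSet K ∧ K ⊆ T ∧
    ∫ x in K, v x = 0 ∧ 0 < ∫ x in K, F x}
  have hstep : ∀ (K : S) (p : Fin (n + 1) × Fin (n + 1) × ℚ × ℚ), ∃ K' : S, K'.1 ⊆ K.1 ∧
      (p.1 ≠ p.2.1 → ∃ θ : ℝ, ∀ x ∈ K'.1,
        0 ≤ Real.cos θ * (x p.1 - p.2.2.1) + Real.sin θ * (x p.2.1 - p.2.2.2)) := by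
    rintro ⟨K, k1, k2, k3, k4, k5⟩ ⟨i, j, c₁, c₂⟩
    by_cases hij : i = j
    · exact ⟨⟨K, k1, k2, k3, k4, k5⟩, subset_rfl, fun h => absurd hij h⟩
    · obtain ⟨θ, t1, t2⟩ := pw_bisect hij c₁ c₂ k2 (pw_intOn (hTb.subset k3) hvc)
        (pw_intOn (hTb.subset k3) hFc) k4 k5
      refine ⟨⟨_, ?_, ?_, Set.inter_subset_left.trans k3, t1, t2⟩, Set.inter_subset_left,
        fun _ => ⟨θ, fun x hx => hx.2⟩⟩
      · refine k1.inter ?_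
        intro x hx y hy a b ha hb hab
        simp only [Set.mem_ofPred_eq, PiLp.add_apply, PiLp.smul_apply, smul_eq_mul] at hx hy ⊢
        have hb' : b = 1 - a := by linarith
        have := add_nonneg (mul_nonneg ha hx) (mul_nonneg hb hy)
        rw [hb'] at this ⊢
        linarith
      · refine k2.inter (IsClosed.measurableSet ?_)
        exact isClosed_le continuous_const (by fun_prop)
  choose step st1 st2 using hstep
  obtain ⟨f, hf⟩ := exists_surjective_nat (Fin (n + 1) × Fin (n + 1) × ℚ × ℚ)
  let K : ℕ → S := fun m => Nat.rec ⟨T, hTc, hTm, subset_rfl, hv0, hFT⟩ (fun m k => step k (f m)) m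
  have hKs : ∀ m, K (m + 1) = step (K m) (f m) := fun m => rfl
  have hKsub : ∀ m, (K (m + 1)).1 ⊆ (K m).1 := fun m => by rw [hKs]; exact st1 _ _
  have hKne : ∀ m, (K m).1.Nonempty := by
    intro m
    by_contra hne
    have h5 := (K m).2.2.2.2.2
    rw [Set.not_nonempty_iff_eq_empty.1 hne] at h5
    simp at h5
  have hanti : Antitone (fun m => closure (K m).1) :=
    antitone_nat_of_succ_le fun m => closure_mono (hKsub m)
  have hcomp : ∀ m, IsCompact (closure (K m).1) := fun m =>
    (hTb.subset (K m).2.2.2.1).isCompact_closure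
  have hne : (⋂ m, closure (K m).1).Nonempty :=
    IsCompact.nonempty_iInter_of_sequence_nonempty_isCompact_isClosed _
      (fun m => closure_mono (hKsub m)) (fun m => (hKne m).closure) (hcomp 0)
      (fun m => isClosed_closure)
  obtain ⟨w, e, he, hline⟩ := pw_line hne (by
    intro i j hij c₁ c₂
    obtain ⟨m, hm⟩ := hf (i, j, c₁, c₂)
    have := st2 (K m) (f m)
    rw [← hKs, hm] at this
    obtain ⟨θ, hθ⟩ := this hij
    refine ⟨θ, fun x hx => ?_⟩
    have hcl : IsClosed {x : EuclideanSpace ℝ (Fin (n + 1)) |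
        0 ≤ Real.cos θ * (x i - c₁) + Real.sin θ * (x j - c₂)} :=
      isClosed_le continuous_const (by fun_prop)
    exact closure_minimal hθ hcl (Set.mem_iInter.1 hx (m + 1)))
  obtain ⟨η, hη0, hη1, hηδ⟩ : ∃ η : ℝ, 0 < η ∧ η ≤ 1 ∧ (2 + C) * η ≤ δ := by
    refine ⟨min 1 (δ / (2 + C)), by positivity, min_le_left _ _, ?_⟩
    calc (2 + C) * min 1 (δ / (2 + C)) ≤ (2 + C) * (δ / (2 + C)) :=
          mul_le_mul_of_nonneg_left (min_le_right _ _) (by positivity)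
      _ = δ := by field_simp
  let U : Set (EuclideanSpace ℝ (Fin (n + 1))) :=
    {x | |v x - v (w + (inner ℝ e x : ℝ) • e)| < η} ∩
    {x | |v x ^ 2 - v (w + (inner ℝ e x : ℝ) • e) ^ 2| < η} ∩
    {x | |‖fderiv ℝ v x‖ ^ 2 - ‖fderiv ℝ v (w + (inner ℝ e x : ℝ) • e)‖ ^ 2| < η}
  have hU : IsOpen U := by
    refine (IsOpen.inter ?_ ?_).inter ?_ <;> exact isOpen_lt (by fun_prop) continuous_const
  have hKU : ∀ x ∈ ⋂ m, closure (K m).1, U ∈ nhds x := by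
    intro x hx
    refine hU.mem_nhds ?_
    have hx' := (hline x hx).symm
    refine ⟨⟨?_, ?_⟩, ?_⟩ <;> simp only [Set.mem_ofPred_eq, hx'] <;> simpa using hη0
  obtain ⟨m, hm⟩ := exists_subset_nhds_of_isCompact' (directed_of_isDirected_le hanti) hcomp
    (fun m => isClosed_closure) hKU
  obtain ⟨k1, k2, k3, k4, k5⟩ := (K m).2
  have hloc := pw_local k1 k2 (hTb.subset k3) ((Metric.diam_mono k3 hTb).trans_lt hL) (w := w) he hv k4
    hη0.le hη1 (fun x hx => (hm (subset_closure hx)).1.1.le)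
    (fun x hx => (hm (subset_closure hx)).1.2.le) (fun x hx => (hm (subset_closure hx)).2.le)
  have hle : ∫ x in (K m).1, (C * ‖fderiv ℝ v x‖ ^ 2 + (2 + C) * η) ≤
      ∫ x in (K m).1, (C * ‖fderiv ℝ v x‖ ^ 2 + δ) := by
    refine setIntegral_mono_on ((ifsq k3).add (icst _ k3)) ((ifsq k3).add (icst _ k3)) k2 ?_
    intro x _
    linarith
  have hsub : ∫ x in (K m).1, F x = (∫ x in (K m).1, v x ^ 2) -
      ∫ x in (K m).1, (C * ‖fderiv ℝ v x‖ ^ 2 + δ) := by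
    have i4 : IntegrableOn (fun x => C * ‖fderiv ℝ v x‖ ^ 2 + δ) (K m).1 :=
      (ifsq k3).add (icst _ k3)
    rw [← integral_sub (ivsq k3) i4]
    simp only [hF, sub_sub]
  linarith

/-- Poincaré inequality with constant `diam(T)/π` on a bounded convex set:
`‖v − Πv‖_{L²(T)} ≤ (H/π) ‖∇v‖_{L²(T)}`, where `Πv` is the mean value of `v`
over `T`. -/
theorem poincare_convex_optimal
    {d : ℕ} (T : Set (EuclideanSpace ℝ (Fin d)))
    (hTconv : Convex ℝ T) (hTbdd : Bornology.IsBounded T)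
    (hTmeas : MeasurableSet T) (hTpos : 0 < volume T)
    (H : ℝ) (hdiam : Metric.diam T ≤ H)
    (v : EuclideanSpace ℝ (Fin d) → ℝ) (hv : ContDiff ℝ 1 v) :
    Real.sqrt (∫ x in T, (v x - ⨍ y in T, v y ∂volume) ^ 2 ∂volume) ≤
      (H / Real.pi) *
        Real.sqrt (∫ x in T, ‖fderiv ℝ v x‖ ^ 2 ∂volume) := by
  have hfin : volume T ≠ ⊤ := hTbdd.measure_lt_top.ne
  have hH : 0 ≤ H := Metric.diam_nonneg.trans hdiam
  have hreal : volume.real T ≠ 0 := (ENNReal.toReal_pos hTpos.ne' hfin).ne'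
  have key : ∫ x in T, (v x - ⨍ y in T, v y ∂volume) ^ 2 ∂volume ≤
      (H / Real.pi) ^ 2 * ∫ x in T, ‖fderiv ℝ v x‖ ^ 2 ∂volume := by
    set a := ⨍ y in T, v y ∂volume with ha
    rcases d with _ | n
    · have h0 : ∀ x, v x = a := by
        intro x
        have hc : v = fun _ => v x := by
          funext y; rw [Subsingleton.elim y x]
        rw [ha, hc, setAverage_eq, setIntegral_const, smul_smul, inv_mul_cancel₀ hreal, one_smul]
      simp only [h0, sub_self]
      simp only [ne_eq, OfNat.ofNat_ne_zero, not_false_eq_true, zero_pow, integral_zero]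
      exact mul_nonneg (by positivity) (integral_nonneg fun x => by positivity)
    · have hu : ContDiff ℝ 1 (fun x => v x - a) := hv.sub contDiff_const
      have hu0 : ∫ x in T, (v x - a) = 0 := by
        rw [integral_sub (pw_intOn hTbdd hv.continuous) (pw_intOn hTbdd continuous_const),
          setIntegral_const, ha, setAverage_eq, smul_smul, mul_inv_cancel₀ hreal, one_smul, sub_self]
      have hL : ∀ L, H < L → ∫ x in T, (v x - a) ^ 2 ≤
          (L / Real.pi) ^ 2 * ∫ x in T, ‖fderiv ℝ v x‖ ^ 2 := by
        intro L hL
        have := pw_core hTconv hTmeas hTbdd (hdiam.trans_lt hL) hu hu0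
        simpa only [fderiv_sub_const] using this
      have ht : Filter.Tendsto (fun L : ℝ => (L / Real.pi) ^ 2 * ∫ x in T, ‖fderiv ℝ v x‖ ^ 2)
          (nhdsWithin H (Set.Ioi H)) (nhds ((H / Real.pi) ^ 2 * ∫ x in T, ‖fderiv ℝ v x‖ ^ 2)) := by
        have : Continuous (fun L : ℝ => (L / Real.pi) ^ 2 * ∫ x in T, ‖fderiv ℝ v x‖ ^ 2) := by
          fun_prop
        exact (this.tendsto H).mono_left nhdsWithin_le_nhds
      exact ge_of_tendsto ht (Filter.eventually_of_mem self_mem_nhdsWithin fun L hl => hL L hl)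
  calc _ ≤ Real.sqrt ((H / Real.pi) ^ 2 * ∫ x in T, ‖fderiv ℝ v x‖ ^ 2 ∂volume) :=
        Real.sqrt_le_sqrt key
    _ = _ := by
        rw [Real.sqrt_mul (by positivity), Real.sqrt_sq (by positivity)]
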